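/- Let f : [0,1]×ℝ²→ℝ be continuous and locally Lipschitz in (x,y), and suppose there exist real numbers K, L₁, L₂ such that f(t,x,y) - f(t,x̃,y) ≤ K(x - x̃) for all x ≥ x̃, t ∈ [0,1], y ∈ ℝ, and L₁(y - ỹ) ≤ f(t,x,y) - f(t,x,ỹ) ≤ L₂(y - ỹ) for all y ≥ ỹ, t ∈ [0,1], x ∈ ℝ. Assume 1 < α(L₂,K) + β(L₁,K). Then for every ω ∈ C₀ there exists a unique u ∈ C¹₀ satisfying u'(t) + ∫₀ᵗ f(s, u(s), u'(s)) ds = u'(0) + ω(t) for all t ∈ [0,1]. -/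

import Mathlib

open MeasureTheory

/-- The Bailey–Shampine–Waltman function `α(L,K)`, with value `+∞` in the
"otherwise" case (hence valued in `EReal`).  Here
`arccosh x = log (x + √(x² - 1))`. -/
noncomputable def alphaBSW (L K : ℝ) : EReal :=
  if 0 < 4 * K - L ^ 2 then
    (((2 / Real.sqrt (4 * K - L ^ 2)) * Real.arccos (L / (2 * Real.sqrt K)) : ℝ) : EReal)
  else if 4 * K - L ^ 2 < 0 ∧ 0 < L ∧ 0 < K then
    (((2 / Real.sqrt (L ^ 2 - 4 * K)) *
      Real.log (L / (2 * Real.sqrt K) +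
        Real.sqrt ((L / (2 * Real.sqrt K)) ^ 2 - 1)) : ℝ) : EReal)
  else if 4 * K - L ^ 2 = 0 ∧ 0 < L then ((2 / L : ℝ) : EReal)
  else ⊤

/-- `β(L,K) = α(-L,K)`. -/
noncomputable def betaBSW (L K : ℝ) : EReal := alphaBSW (-L) K

/-- `u ∈ C¹₀` (with derivative `u'`) solves the integral equation
`u'(t) + ∫₀ᵗ f(s,u,u') ds = u'(0) + ω(t)` on `[0,1]`. -/
def SolBVP (f : ℝ → ℝ → ℝ → ℝ) (ω : ℝ → ℝ) (u u' : ℝ → ℝ) : Prop :=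
  (∀ t ∈ Set.Icc (0:ℝ) 1, HasDerivWithinAt u (u' t) (Set.Icc 0 1) t) ∧
  ContinuousOn u' (Set.Icc 0 1) ∧ u 0 = 0 ∧ u 1 = 0 ∧
  ∀ t ∈ Set.Icc (0:ℝ) 1,
    u' t + ∫ s in (0:ℝ)..t, f s (u s) (u' s) = u' 0 + ω t


theorem exists_weak_supersolution {L K τ : ℝ} (hK : 0 ≤ K)
    (h : (τ : EReal) < alphaBSW L K) :
    ∃ τ' > τ, ∃ ψ ψ₁ ψ₂ : ℝ → ℝ, (∀ t, HasDerivAt ψ (ψ₁ t) t) ∧ (∀ t, HasDerivAt ψ₁ (ψ₂ t) t) ∧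
      ∀ t ∈ Set.Ioo 0 τ', 0 < ψ t ∧ 0 < ψ₁ t ∧ ψ₂ t + L * ψ₁ t + K * ψ t ≤ 0 := by
  unfold alphaBSW at h
  have hE (c t : ℝ) : HasDerivAt (fun t => Real.exp (c * t)) (c * Real.exp (c * t)) t := by
    simpa [mul_comm] using ((hasDerivAt_id t).const_mul c).exp
  split_ifs at h with h1 h2 h3
  · have hK0 : 0 < K := by nlinarith [sq_nonneg L]
    set w := Real.sqrt (4 * K - L ^ 2) / 2 with hw
    have hw0 : 0 < w := by positivity
    have hw2 : w ^ 2 = K - L ^ 2 / 4 := by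
      rw [hw, div_pow, Real.sq_sqrt h1.le]; ring
    set θ := Real.arccos (L / (2 * Real.sqrt K)) with hθ
    have hs0 : 0 < Real.sqrt K := Real.sqrt_pos.2 hK0
    have hs2 := Real.sq_sqrt hK0.le
    have hLs : |L| ≤ 2 * Real.sqrt K := by
      apply abs_le_of_sq_le_sq _ (by positivity)
      nlinarith
    have hcos : Real.sqrt K * Real.cos θ = L / 2 := by
      rw [hθ, Real.cos_arccos]
      · field_simp
      · rw [le_div_iff₀ (by positivity)]; linarith [(abs_le.1 hLs).1]
      · rw [div_le_iff₀ (by positivity)]; linarith [(abs_le.1 hLs).2]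
    have hsin : Real.sqrt K * Real.sin θ = w := by
      rw [← abs_of_pos hw0, ← abs_of_nonneg (a := Real.sqrt K * Real.sin θ)
        (mul_nonneg hs0.le (Real.sin_nonneg_of_nonneg_of_le_pi (Real.arccos_nonneg _)
          (Real.arccos_le_pi _))), ← sq_eq_sq_iff_abs_eq_abs]
      have := Real.sin_sq_add_cos_sq θ
      have h4 : (Real.sqrt K * Real.cos θ) ^ 2 = L ^ 2 / 4 := by rw [hcos]; ring
      rw [mul_pow] at h4 ⊢
      rw [hs2] at *
      rw [hw2]
      linear_combination K * this - h4
    refine ⟨θ / w, ?_, fun t => Real.exp (-(L / 2) * t) * Real.sin (w * t),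
      fun t => Real.exp (-(L / 2) * t) * (w * Real.cos (w * t) - L / 2 * Real.sin (w * t)),
      fun t => Real.exp (-(L / 2) * t) * (-w ^ 2 * Real.sin (w * t) - L * w * Real.cos (w * t)
        + L ^ 2 / 4 * Real.sin (w * t)), fun t => ?_, fun t => ?_, fun t ht => ?_⟩
    · have := EReal.coe_lt_coe_iff.1 h
      refine this.trans_eq ?_
      rw [hw]; field_simp
    · refine HasDerivAt.congr_deriv ((hE (-(L / 2)) t).mul (((hasDerivAt_id t).const_mul w).sin)) ?_
      simp; ring
    · refine HasDerivAt.congr_deriv ((hE (-(L / 2)) t).mul (((((hasDerivAt_id t).const_mul w).cos).const_mul w).sub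
        ((((hasDerivAt_id t).const_mul w).sin).const_mul (L / 2)))) ?_
      simp; ring
    · have h5 : 0 < w * t := mul_pos hw0 ht.1
      have h6 : w * t < θ := by
        have := ht.2
        rw [lt_div_iff₀ hw0] at this
        linarith
      have h7 : θ ≤ Real.pi := Real.arccos_le_pi _
      refine ⟨mul_pos (Real.exp_pos _) (Real.sin_pos_of_pos_of_lt_pi h5 (by linarith)),
        mul_pos (Real.exp_pos _) ?_, le_of_eq ?_⟩
      · have h8 : 0 < Real.sqrt K * Real.sin (θ - w * t) :=
          mul_pos hs0 (Real.sin_pos_of_pos_of_lt_pi (by linarith) (by linarith))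
        rw [Real.sin_sub] at h8
        rw [← hcos]
        nth_rw 1 [← hsin]
        linarith
      · rw [hw2]; ring
  · obtain ⟨h1', hL0, hK0⟩ := h2
    have h1'' : 0 < L ^ 2 - 4 * K := by linarith
    set w := Real.sqrt (L ^ 2 - 4 * K) / 2 with hw
    have hw0 : 0 < w := by positivity
    have hw2 : w ^ 2 = L ^ 2 / 4 - K := by
      rw [hw, div_pow, Real.sq_sqrt h1''.le]; ring
    have hs0 : 0 < Real.sqrt K := Real.sqrt_pos.2 hK0
    have hs2 := Real.sq_sqrt hK0.le
    have hLs : 1 ≤ L / (2 * Real.sqrt K) := by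
      rw [le_div_iff₀ (by positivity), one_mul]
      apply le_of_sq_le_sq _ hL0.le
      nlinarith
    change ((_ : ℝ) : EReal) < ((_ * Real.arcosh (L / (2 * Real.sqrt K)) : ℝ) : EReal) at h
    set θ := Real.arcosh (L / (2 * Real.sqrt K)) with hθ
    have hcos : Real.sqrt K * Real.cosh θ = L / 2 := by
      rw [hθ, Real.cosh_arcosh hLs]
      field_simp
    have hθ0 : 0 ≤ θ := Real.arcosh_nonneg hLs
    have hsin : Real.sqrt K * Real.sinh θ = w := by
      rw [← abs_of_pos hw0, ← abs_of_nonneg (a := Real.sqrt K * Real.sinh θ)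
        (mul_nonneg hs0.le (Real.sinh_nonneg_iff.2 hθ0)), ← sq_eq_sq_iff_abs_eq_abs]
      have := Real.cosh_sq θ
      have h4 : (Real.sqrt K * Real.cosh θ) ^ 2 = L ^ 2 / 4 := by rw [hcos]; ring
      rw [mul_pow] at h4 ⊢
      rw [hs2] at *
      rw [hw2]
      linear_combination (-K) * this + h4
    refine ⟨θ / w, ?_, fun t => Real.exp (-(L / 2) * t) * Real.sinh (w * t),
      fun t => Real.exp (-(L / 2) * t) * (w * Real.cosh (w * t) - L / 2 * Real.sinh (w * t)),
      fun t => Real.exp (-(L / 2) * t) * (w ^ 2 * Real.sinh (w * t) - L * w * Real.cosh (w * t)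
        + L ^ 2 / 4 * Real.sinh (w * t)), fun t => ?_, fun t => ?_, fun t ht => ?_⟩
    · have := EReal.coe_lt_coe_iff.1 h
      refine this.trans_eq ?_
      rw [hw]; field_simp
    · refine HasDerivAt.congr_deriv ((hE (-(L / 2)) t).mul (((hasDerivAt_id t).const_mul w).sinh)) ?_
      simp; ring
    · refine HasDerivAt.congr_deriv ((hE (-(L / 2)) t).mul (((((hasDerivAt_id t).const_mul w).cosh).const_mul w).sub
        ((((hasDerivAt_id t).const_mul w).sinh).const_mul (L / 2)))) ?_
      simp; ring
    · have h5 : 0 < w * t := mul_pos hw0 ht.1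
      have h6 : w * t < θ := by
        have := ht.2
        rw [lt_div_iff₀ hw0] at this
        linarith
      refine ⟨mul_pos (Real.exp_pos _) (Real.sinh_pos_iff.2 h5),
        mul_pos (Real.exp_pos _) ?_, le_of_eq ?_⟩
      · have h8 : 0 < Real.sqrt K * Real.sinh (θ - w * t) :=
          mul_pos hs0 (Real.sinh_pos_iff.2 (by linarith))
        rw [Real.sinh_sub] at h8
        rw [← hcos]
        nth_rw 1 [← hsin]
        linarith
      · rw [hw2]; ring
  · obtain ⟨hD, hL0⟩ := h3
    refine ⟨2 / L, EReal.coe_lt_coe_iff.1 h, fun t => Real.exp (-(L / 2) * t) * t,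
      fun t => Real.exp (-(L / 2) * t) * (1 - L / 2 * t),
      fun t => Real.exp (-(L / 2) * t) * (L ^ 2 / 4 * t - L), fun t => ?_, fun t => ?_,
      fun t ht => ?_⟩
    · refine HasDerivAt.congr_deriv ((hE (-(L / 2)) t).mul (hasDerivAt_id t)) ?_
      simp; ring
    · refine HasDerivAt.congr_deriv ((hE (-(L / 2)) t).mul (((hasDerivAt_id t).const_mul (L / 2)).const_sub 1)) ?_
      simp; ring
    · have := ht.2
      rw [lt_div_iff₀ hL0] at this
      refine ⟨mul_pos (Real.exp_pos _) ht.1, mul_pos (Real.exp_pos _) (by linarith), le_of_eq ?_⟩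
      rw [show K = L ^ 2 / 4 by linarith]; ring
  · rcases lt_or_ge L 0 with hL | hL
    · have hD : 0 ≤ L ^ 2 - 4 * K := by linarith
      have hs := Real.sq_sqrt hD
      set s := Real.sqrt (L ^ 2 - 4 * K)
      set r := (-L + s) / 2 with hr
      have hr0 : 0 < r := by
        have : 0 ≤ s := Real.sqrt_nonneg _
        rw [hr]; linarith
      refine ⟨τ + 1, by simp, fun t => Real.exp (r * t), fun t => r * Real.exp (r * t),
        fun t => r * (r * Real.exp (r * t)), hE r, fun t => (hE r t).const_mul r, fun t _ =>
        ⟨Real.exp_pos _, mul_pos hr0 (Real.exp_pos _), le_of_eq ?_⟩⟩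
      have : r ^ 2 + L * r + K = 0 := by rw [hr]; linear_combination hs / 4
      linear_combination Real.exp (r * t) * this
    · have hK0 : K = 0 := by
        by_contra hne
        have hKpos : 0 < K := lt_of_le_of_ne hK (Ne.symm hne)
        have hLpos : 0 < L := by
          rcases hL.eq_or_lt with h0 | h0
          · rw [← h0] at h1; norm_num at h1; linarith
          · exact h0
        rcases lt_trichotomy (4 * K - L ^ 2) 0 with h0 | h0 | h0
        · exact h2 ⟨h0, hLpos, hKpos⟩
        · exact h3 ⟨h0, hLpos⟩
        · exact h1 h0
      refine ⟨τ + 1, by simp, fun t => 2 - Real.exp (-(L + 1) * t),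
        fun t => (L + 1) * Real.exp (-(L + 1) * t),
        fun t => (L + 1) * (-(L + 1) * Real.exp (-(L + 1) * t)), fun t => ?_,
        fun t => (hE _ t).const_mul _, fun t ht => ?_⟩
      · refine HasDerivAt.congr_deriv ((hE (-(L + 1)) t).const_sub 2) ?_
        simp; ring
      · have he : Real.exp (-(L + 1) * t) ≤ 1 := Real.exp_le_one_iff.2 (by nlinarith [ht.1])
        have hp := Real.exp_pos (-(L + 1) * t)
        refine ⟨by linarith, by positivity, ?_⟩
        rw [hK0]
        nlinarith

theorem exists_supersolution {L K τ : ℝ} (hK : 0 ≤ K) (hτ : 0 < τ)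
    (h : (τ : EReal) < alphaBSW L K) :
    ∃ ψ ψ₁ ψ₂ : ℝ → ℝ, (∀ t, HasDerivAt ψ (ψ₁ t) t) ∧ (∀ t, HasDerivAt ψ₁ (ψ₂ t) t) ∧
      ∀ t ∈ Set.Icc 0 τ, 0 < ψ t ∧ 0 < ψ₁ t ∧ ψ₂ t + L * ψ₁ t + K * ψ t ≤ -1 := by
  obtain ⟨τ', hτ', ψ, ψ₁, ψ₂, hd, hd₁, hp⟩ := exists_weak_supersolution hK h
  obtain ⟨ε, hε⟩ : ∃ ε, ε = (τ' - τ) / 2 := ⟨_, rfl⟩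
  have hmem : ∀ t ∈ Set.Icc 0 τ, t + ε ∈ Set.Ioo 0 τ' := fun t ht =>
    ⟨by linarith [ht.1], by linarith [ht.2]⟩
  have hc : Continuous ψ := continuous_iff_continuousAt.2 fun t => (hd t).continuousAt
  have hc₁ : Continuous ψ₁ := continuous_iff_continuousAt.2 fun t => (hd₁ t).continuousAt
  have hmin : ∃ m > 0, ∀ t ∈ Set.Icc 0 τ, m ≤ ψ (t + ε) ∧ m ≤ ψ₁ (t + ε) := by
    have hcm : Continuous fun t => min (ψ (t + ε)) (ψ₁ (t + ε)) := by fun_prop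
    obtain ⟨t₀, ht₀, hle⟩ := (isCompact_Icc (a := (0 : ℝ)) (b := τ)).exists_isMinOn
      (Set.nonempty_Icc.2 hτ.le) hcm.continuousOn
    have := hp _ (hmem t₀ ht₀)
    exact ⟨_, lt_min this.1 this.2.1, fun t ht =>
      ⟨(hle ht).trans (min_le_left _ _), (hle ht).trans (min_le_right _ _)⟩⟩
  obtain ⟨m, hm, hmle⟩ := hmin
  obtain ⟨μ, hμ⟩ : ∃ μ, μ = |L| + 1 := ⟨_, rfl⟩
  have hμ1 : 1 ≤ μ := by rw [hμ]; linarith [abs_nonneg L]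
  obtain ⟨C, hC⟩ : ∃ C, C = (μ * Real.exp (μ * τ) + 1) / m := ⟨_, rfl⟩
  have hCm : C * m = μ * Real.exp (μ * τ) + 1 := by rw [hC]; field_simp
  have hC0 : 0 < C := by rw [hC]; positivity
  have hE (t : ℝ) : HasDerivAt (fun t => Real.exp (μ * t)) (μ * Real.exp (μ * t)) t := by
    simpa [mul_comm] using ((hasDerivAt_id t).const_mul μ).exp
  refine ⟨fun t => C * ψ (t + ε) - Real.exp (μ * t),
    fun t => C * ψ₁ (t + ε) - μ * Real.exp (μ * t),
    fun t => C * ψ₂ (t + ε) - μ * (μ * Real.exp (μ * t)),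
    fun t => (((hd (t + ε)).comp_add_const t ε).const_mul C).sub (hE t),
    fun t => (((hd₁ (t + ε)).comp_add_const t ε).const_mul C).sub ((hE t).const_mul μ),
    fun t ht => ?_⟩
  obtain ⟨h1, h2⟩ := hmle t ht
  obtain ⟨-, -, h3⟩ := hp _ (hmem t ht)
  have he : Real.exp (μ * t) ≤ Real.exp (μ * τ) :=
    Real.exp_le_exp.2 (mul_le_mul_of_nonneg_left ht.2 (by linarith))
  have he1 : 1 ≤ Real.exp (μ * t) := Real.one_le_exp (mul_nonneg (by linarith) ht.1)
  have h4 := mul_le_mul_of_nonneg_left h1 hC0.le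
  have h5 := mul_le_mul_of_nonneg_left h2 hC0.le
  have h6 : μ * Real.exp (μ * t) ≤ μ * Real.exp (μ * τ) :=
    mul_le_mul_of_nonneg_left he (by linarith)
  have h7 : Real.exp (μ * t) ≤ μ * Real.exp (μ * t) := le_mul_of_one_le_left (by linarith) hμ1
  refine ⟨by linarith, by linarith, ?_⟩
  have h8 : 1 ≤ μ ^ 2 + L * μ + K := by
    have : μ ^ 2 + L * μ = μ * (|L| + L) + μ := by rw [hμ]; ring
    nlinarith [neg_abs_le L]
  have h9 := mul_le_mul_of_nonneg_left h3 hC0.le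
  have h10 := mul_le_mul_of_nonneg_right h8 (show 0 ≤ Real.exp (μ * t) by linarith)
  dsimp only
  linarith

open Filter Topology in
theorem nonneg_of_hasDerivAt_of_le_left {z : ℝ → ℝ} {d τ : ℝ} (hz : HasDerivAt z d τ)
    (h : ∀ᶠ t in 𝓝[<] τ, z t ≤ z τ) : 0 ≤ d := by
  have h1 := (hasDerivAt_iff_tendsto_slope.1 hz).mono_left (nhdsLT_le_nhdsNE τ)
  refine ge_of_tendsto h1 ?_
  filter_upwards [h, self_mem_nhdsWithin] with t ht hlt
  rw [slope_def_field]
  exact div_nonneg_of_nonpos (by linarith) (by linarith [Set.mem_Iio.1 hlt])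

open Filter Topology in
theorem nonpos_of_hasDerivAt_of_le_right {z : ℝ → ℝ} {d τ : ℝ} (hz : HasDerivAt z d τ)
    (h : ∀ᶠ t in 𝓝[>] τ, z t ≤ z τ) : d ≤ 0 := by
  have h1 := (hasDerivAt_iff_tendsto_slope.1 hz).mono_left (nhdsGT_le_nhdsNE τ)
  refine le_of_tendsto h1 ?_
  filter_upwards [h, self_mem_nhdsWithin] with t ht hlt
  rw [slope_def_field]
  exact div_nonpos_of_nonpos_of_nonneg (by linarith) (by linarith [Set.mem_Ioi.1 hlt])

open Filter Topology in
theorem IsLocalMax.second_deriv_nonpos {z z₁ : ℝ → ℝ} {d t₀ : ℝ} (hmax : IsLocalMax z t₀)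
    (hz : ∀ᶠ t in 𝓝 t₀, HasDerivAt z (z₁ t) t) (hz₁ : HasDerivAt z₁ d t₀) : d ≤ 0 := by
  by_contra! hd
  have h0 : deriv z =ᶠ[𝓝 t₀] z₁ := hz.mono fun t ht => ht.deriv
  have h1 : deriv (deriv z) t₀ = d := h0.deriv_eq.trans hz₁.deriv
  have hmin : IsLocalMin z t₀ := isLocalMin_of_deriv_deriv_pos (by rwa [h1]) hmax.deriv_eq_zero
    hz.self_of_nhds.continuousAt
  have h2 : z =ᶠ[𝓝 t₀] fun _ => z t₀ := by
    filter_upwards [hmax, hmin] with t h3 h4 using le_antisymm h3 h4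
  have h3 : deriv (deriv z) t₀ = 0 := by
    rw [h2.deriv.deriv_eq]; simp
  linarith

/-- A positive function on `[0,1]` that is a strict supersolution, in the sense of test functions
touching it from below, of `φ'' + l φ' + K φ ≤ -1` for all `l ∈ [L₁, L₂]`. -/
structure IsBarrier (L₁ L₂ K : ℝ) (φ : ℝ → ℝ) : Prop where
  continuousOn : ContinuousOn φ (Set.Icc 0 1)
  pos : ∀ t ∈ Set.Icc (0 : ℝ) 1, 0 < φ t
  touch : ∀ w w₁ w₂ : ℝ → ℝ,
    (∀ t ∈ Set.Ioo (0 : ℝ) 1, HasDerivAt w (w₁ t) t ∧ HasDerivAt w₁ (w₂ t) t) →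
    (∀ t ∈ Set.Icc (0 : ℝ) 1, w t ≤ φ t) → ∀ t ∈ Set.Ioo (0 : ℝ) 1, w t = φ t →
    ∀ l ∈ Set.Icc L₁ L₂, w₂ t + l * w₁ t + K * w t ≤ -1

open Filter Topology in
theorem touch_of_smooth {φ φ₁ φ₂ w w₁ w₂ : ℝ → ℝ} {K l t : ℝ} (ht : t ∈ Set.Ioo (0 : ℝ) 1)
    (hw : ∀ t ∈ Set.Ioo (0 : ℝ) 1, HasDerivAt w (w₁ t) t ∧ HasDerivAt w₁ (w₂ t) t)
    (hφ : ∀ t, HasDerivAt φ (φ₁ t) t) (hφ₁ : ∀ t, HasDerivAt φ₁ (φ₂ t) t)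
    (hle : ∀ᶠ s in 𝓝 t, w s ≤ φ s) (heq : w t = φ t)
    (h : φ₂ t + l * φ₁ t + K * φ t ≤ -1) : w₂ t + l * w₁ t + K * w t ≤ -1 := by
  have hmax : IsLocalMax (fun s => w s - φ s) t := by
    filter_upwards [hle] with s hs
    simp only [heq]
    linarith
  have hd : ∀ᶠ s in 𝓝 t, HasDerivAt (fun s => w s - φ s) (w₁ s - φ₁ s) s := by
    filter_upwards [isOpen_Ioo.mem_nhds ht] with s hs using (hw s hs).1.sub (hφ s)
  have h1 := hmax.hasDerivAt_eq_zero hd.self_of_nhds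
  have h2 := hmax.second_deriv_nonpos hd ((hw t ht).2.sub (hφ₁ t))
  rw [show w₁ t = φ₁ t by linarith, heq]
  linarith

theorem exists_split {a b : EReal} (ha : 0 < a) (hb : 0 < b) (h : 1 < a + b) :
    ∃ τ : ℝ, 0 < τ ∧ τ < 1 ∧ (τ : EReal) < a ∧ ((1 - τ : ℝ) : EReal) < b := by
  have key : ∀ c : EReal, 0 < c → ∃ r : ℝ, 0 < r ∧ r ≤ 1 ∧ (r : EReal) ≤ c ∧ (r < 1 → c = r) := by
    intro c hc
    induction c with
    | bot => simp at hc
    | top => exact ⟨1, one_pos, le_rfl, le_top, fun h => absurd h (lt_irrefl _)⟩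
    | coe x =>
      have hx : 0 < x := by exact_mod_cast hc
      refine ⟨min x 1, lt_min hx one_pos, min_le_right _ _, by exact_mod_cast min_le_left _ _,
        fun h => ?_⟩
      rw [min_eq_left]
      by_contra! h'
      rw [min_eq_right h'.le] at h
      exact lt_irrefl _ h
  obtain ⟨r, hr0, hr1, hra, hra'⟩ := key a ha
  obtain ⟨s, hs0, hs1, hsb, hsb'⟩ := key b hb
  have hrs : 1 < r + s := by
    rcases hr1.eq_or_lt with h1 | h1
    · linarith
    · rcases hs1.eq_or_lt with h2 | h2
      · linarith
      · rw [hra' h1, hsb' h2] at h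
        exact_mod_cast h
  refine ⟨(r + 1 - s) / 2, by linarith, by linarith, lt_of_lt_of_le ?_ hra, lt_of_lt_of_le ?_ hsb⟩
  · exact_mod_cast (by linarith : (r + 1 - s) / 2 < r)
  · exact_mod_cast (by linarith : 1 - (r + 1 - s) / 2 < s)

theorem alphaBSW_pos (L K : ℝ) : 0 < alphaBSW L K := by
  unfold alphaBSW
  split_ifs with h1 h2 h3
  · have hK0 : 0 < K := by nlinarith [sq_nonneg L]
    have hs0 : 0 < Real.sqrt K := Real.sqrt_pos.2 hK0
    have : 0 < Real.arccos (L / (2 * Real.sqrt K)) := by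
      rw [Real.arccos_pos, div_lt_one (by positivity)]
      apply lt_of_pow_lt_pow_left₀ 2 (by positivity)
      nlinarith [Real.sq_sqrt hK0.le]
    have h4 := Real.sqrt_pos.2 h1
    exact_mod_cast mul_pos (div_pos two_pos h4) this
  · obtain ⟨h1', hL0, hK0⟩ := h2
    have hs0 : 0 < Real.sqrt K := Real.sqrt_pos.2 hK0
    have : 0 < Real.arcosh (L / (2 * Real.sqrt K)) := by
      apply Real.arcosh_pos
      rw [one_lt_div (by positivity)]
      apply lt_of_pow_lt_pow_left₀ 2 hL0.le
      nlinarith [Real.sq_sqrt hK0.le]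
    have h4 : 0 < Real.sqrt (L ^ 2 - 4 * K) := Real.sqrt_pos.2 (by linarith)
    exact_mod_cast mul_pos (div_pos two_pos h4) this
  · exact_mod_cast div_pos two_pos h3.2
  · simp

theorem alphaBSW_of_nonpos (L : ℝ) {K : ℝ} (hK : K ≤ 0) : alphaBSW L K = ⊤ := by
  unfold alphaBSW
  rw [if_neg (by nlinarith [sq_nonneg L]), if_neg (by rintro ⟨-, -, h⟩; linarith), if_neg]
  rintro ⟨h1, h2⟩
  nlinarith

open Filter Topology in
theorem exists_barrier {L₁ L₂ K : ℝ} (hK : 0 ≤ K)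
    (h : (1 : EReal) < alphaBSW L₂ K + betaBSW L₁ K) : ∃ φ, IsBarrier L₁ L₂ K φ := by
  obtain ⟨τ, hτ0, hτ1, ha, hb⟩ := exists_split (alphaBSW_pos _ _) (alphaBSW_pos _ _) h
  obtain ⟨a, a₁, a₂, hda, hda₁, hpa⟩ := exists_supersolution hK hτ0 ha
  obtain ⟨b, b₁, b₂, hdb, hdb₁, hpb⟩ := exists_supersolution hK (sub_pos.2 hτ1) hb
  have hpτ := (hpa τ ⟨hτ0.le, le_rfl⟩).1
  have hqτ := (hpb (1 - τ) ⟨by linarith, le_rfl⟩).1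
  obtain ⟨A, hA1, B, hB1, hAB⟩ : ∃ A ≥ 1, ∃ B ≥ 1, A * a τ = B * b (1 - τ) := by
    refine ⟨(a τ + b (1 - τ)) / a τ, ?_, (a τ + b (1 - τ)) / b (1 - τ), ?_, by field_simp⟩
    · rw [ge_iff_le, le_div_iff₀ hpτ]; linarith
    · rw [ge_iff_le, le_div_iff₀ hqτ]; linarith
  have hdA := fun t => (hda t).const_mul A
  have hdA₁ := fun t => (hda₁ t).const_mul A
  have hdB : ∀ t, HasDerivAt (fun t => B * b (1 - t)) (-(B * b₁ (1 - t))) t := fun t =>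
    (((hdb (1 - t)).comp_const_sub 1 t).const_mul B).congr_deriv (by ring)
  have hdB₁ : ∀ t, HasDerivAt (fun t => -(B * b₁ (1 - t))) (B * b₂ (1 - t)) t := fun t =>
    (((hdb₁ (1 - t)).comp_const_sub 1 t).const_mul B).neg.congr_deriv (by ring)
  obtain ⟨φ, hφ⟩ : ∃ φ : ℝ → ℝ, φ = fun t => if t ≤ τ then A * a t else B * b (1 - t) := ⟨_, rfl⟩
  have hφa : ∀ t ≤ τ, φ t = A * a t := fun t ht => by rw [hφ]; exact if_pos ht
  have hφb : ∀ t ≥ τ, φ t = B * b (1 - t) := fun t ht => by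
    rcases ht.eq_or_lt with h1 | h1
    · rw [← h1, hφa τ le_rfl, hAB]
    · rw [hφ]; exact if_neg (not_le.2 h1)
  refine ⟨φ, ?_, fun t ht => ?_, fun w w₁ w₂ hw hle t ht heq l hl => ?_⟩
  · rw [hφ]
    refine (Continuous.if_le (continuous_iff_continuousAt.2 fun t => (hdA t).continuousAt)
      (continuous_iff_continuousAt.2 fun t => (hdB t).continuousAt) continuous_id
      continuous_const ?_).continuousOn
    rintro t rfl
    exact hAB
  · rcases le_total t τ with h1 | h1
    · rw [hφa t h1]; exact mul_pos (by linarith) (hpa t ⟨ht.1, h1⟩).1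
    · rw [hφb t h1]
      exact mul_pos (by linarith) (hpb (1 - t) ⟨by linarith [ht.2], by linarith⟩).1
  · have hev : ∀ᶠ s in 𝓝 t, s ∈ Set.Icc (0 : ℝ) 1 := Icc_mem_nhds ht.1 ht.2
    rcases lt_trichotomy t τ with h1 | h1 | h1
    · refine touch_of_smooth ht hw hdA hdA₁ ?_ (heq.trans (hφa t h1.le)) ?_
      · filter_upwards [hev, eventually_le_nhds h1] with s hs hs'
        exact (hle s hs).trans_eq (hφa s hs')
      · obtain ⟨-, h2, h3⟩ := hpa t ⟨ht.1.le, h1.le⟩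
        have h4 : l * a₁ t ≤ L₂ * a₁ t := mul_le_mul_of_nonneg_right hl.2 h2.le
        nlinarith
    · exfalso
      subst h1
      have h2 := nonneg_of_hasDerivAt_of_le_left ((hw t ht).1.sub (hdA t)) (by
        filter_upwards [nhdsWithin_le_nhds hev, self_mem_nhdsWithin] with s hs hs'
        have := hle s hs
        rw [hφa s (le_of_lt hs')] at this
        have := heq.trans (hφa t le_rfl)
        simp only [Pi.sub_apply]
        linarith)
      have h3 := nonpos_of_hasDerivAt_of_le_right ((hw t ht).1.sub (hdB t)) (by
        filter_upwards [nhdsWithin_le_nhds hev, self_mem_nhdsWithin] with s hs hs'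
        have := hle s hs
        rw [hφb s (le_of_lt hs')] at this
        have := heq.trans (hφb t le_rfl)
        simp only [Pi.sub_apply]
        linarith)
      have h4 := mul_pos (show 0 < A by linarith) (hpa t ⟨ht.1.le, le_rfl⟩).2.1
      have h5 := mul_pos (show 0 < B by linarith) (hpb (1 - t) ⟨by linarith [ht.2], le_rfl⟩).2.1
      linarith
    · refine touch_of_smooth ht hw hdB hdB₁ ?_ (heq.trans (hφb t h1.le)) ?_
      · filter_upwards [hev, eventually_ge_nhds h1] with s hs hs'
        exact (hle s hs).trans_eq (hφb s hs')
      · obtain ⟨-, h2, h3⟩ := hpb (1 - t) ⟨by linarith [ht.2], by linarith⟩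
        have h4 : L₁ * b₁ (1 - t) ≤ l * b₁ (1 - t) := mul_le_mul_of_nonneg_right hl.1 h2.le
        nlinarith

theorem IsBarrier.le_mul {L₁ L₂ K M : ℝ} {φ w w₁ w₂ : ℝ → ℝ} (hφ : IsBarrier L₁ L₂ K φ)
    (hM : 0 ≤ M) (hc : ContinuousOn w (Set.Icc 0 1))
    (hw : ∀ t ∈ Set.Ioo (0 : ℝ) 1, HasDerivAt w (w₁ t) t ∧ HasDerivAt w₁ (w₂ t) t)
    (h0 : w 0 ≤ 0) (h1 : w 1 ≤ 0)
    (hsub : ∀ t ∈ Set.Ioo (0 : ℝ) 1, 0 < w t → ∃ l ∈ Set.Icc L₁ L₂,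
      -M ≤ w₂ t + l * w₁ t + K * w t) :
    ∀ t ∈ Set.Icc (0 : ℝ) 1, w t ≤ M * φ t := by
  obtain ⟨t₀, ht₀, hmax⟩ := (isCompact_Icc (a := (0 : ℝ)) (b := 1)).exists_isMaxOn
    (Set.nonempty_Icc.2 zero_le_one) (hc.div hφ.continuousOn fun t ht => (hφ.pos t ht).ne')
  obtain ⟨m, hm⟩ : ∃ m, m = w t₀ / φ t₀ := ⟨_, rfl⟩
  have hle : ∀ t ∈ Set.Icc (0 : ℝ) 1, w t ≤ m * φ t := fun t ht => by
    rw [← div_le_iff₀ (hφ.pos t ht), hm]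
    exact hmax ht
  suffices hmM : m ≤ M from fun t ht =>
    (hle t ht).trans (mul_le_mul_of_nonneg_right hmM (hφ.pos t ht).le)
  by_contra! hMm
  have hm0 : 0 < m := hM.trans_lt hMm
  have heq : w t₀ = m * φ t₀ := by rw [hm, div_mul_cancel₀ _ (hφ.pos t₀ ht₀).ne']
  have hpos : 0 < w t₀ := heq ▸ mul_pos hm0 (hφ.pos t₀ ht₀)
  have hin : t₀ ∈ Set.Ioo (0 : ℝ) 1 := by
    refine ⟨lt_of_le_of_ne ht₀.1 ?_, lt_of_le_of_ne ht₀.2 ?_⟩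
    · rintro rfl; linarith
    · rintro rfl; linarith
  obtain ⟨l, hl, hlM⟩ := hsub t₀ hin hpos
  have := hφ.touch (fun t => m⁻¹ * w t) (fun t => m⁻¹ * w₁ t) (fun t => m⁻¹ * w₂ t)
    (fun t ht => ⟨(hw t ht).1.const_mul _, (hw t ht).2.const_mul _⟩)
    (fun t ht => by
      rw [inv_mul_le_iff₀ hm0]; exact hle t ht) t₀ hin
    (by rw [heq]; field_simp) l hl
  have h2 : m⁻¹ * (w₂ t₀ + l * w₁ t₀ + K * w t₀) ≤ -1 := by linarith
  rw [inv_mul_le_iff₀ hm0] at h2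
  linarith

/-- The one-sided Lipschitz conditions on the nonlinearity. -/
structure OneSided (L₁ L₂ K : ℝ) (f : ℝ → ℝ → ℝ → ℝ) : Prop where
  le_fst : ∀ t ∈ Set.Icc (0 : ℝ) 1, ∀ y x x' : ℝ, x' ≤ x → f t x y - f t x' y ≤ K * (x - x')
  snd : ∀ t ∈ Set.Icc (0 : ℝ) 1, ∀ x y y' : ℝ, y' ≤ y →
    L₁ * (y - y') ≤ f t x y - f t x y' ∧ f t x y - f t x y' ≤ L₂ * (y - y')

namespace OneSided

variable {L₁ L₂ K : ℝ} {f g : ℝ → ℝ → ℝ → ℝ}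

theorem le_slopes (hf : OneSided L₁ L₂ K f) : L₁ ≤ L₂ := by
  have := hf.snd 0 (by simp) 0 1 0 zero_le_one
  linarith [this.1, this.2]

theorem combo (hf : OneSided L₁ L₂ K f) (hg : OneSided L₁ L₂ K g) {r : ℝ}
    (hr : r ∈ Set.Icc (0 : ℝ) 1) :
    OneSided L₁ L₂ K fun t x y => f t x y + r * (g t x y - f t x y) := by
  obtain ⟨hr0, hr1⟩ := hr
  have hr1' : 0 ≤ 1 - r := by linarith
  refine ⟨fun t ht y x x' hx => ?_, fun t ht x y y' hy => ?_⟩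
  · have h1 := mul_le_mul_of_nonneg_left (hf.le_fst t ht y x x' hx) hr1'
    have h2 := mul_le_mul_of_nonneg_left (hg.le_fst t ht y x x' hx) hr0
    linarith
  · obtain ⟨a1, a2⟩ := hf.snd t ht x y y' hy
    obtain ⟨b1, b2⟩ := hg.snd t ht x y y' hy
    have h1 := mul_le_mul_of_nonneg_left a1 hr1'
    have h2 := mul_le_mul_of_nonneg_left a2 hr1'
    have h3 := mul_le_mul_of_nonneg_left b1 hr0
    have h4 := mul_le_mul_of_nonneg_left b2 hr0
    constructor <;> linarith

/-- Comparison principle: the barrier controls `u - v` by the size of the residuals. -/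
theorem sub_le_mul {φ u u₁ v v₁ d : ℝ → ℝ} {M : ℝ} (hf : OneSided L₁ L₂ K f)
    (hφ : IsBarrier L₁ L₂ K φ) (hM : 0 ≤ M)
    (hc : ContinuousOn (fun t => u t - v t) (Set.Icc 0 1))
    (hd : ∀ t ∈ Set.Ioo (0 : ℝ) 1, HasDerivAt (fun t => u t - v t) (u₁ t - v₁ t) t)
    (hd₁ : ∀ t ∈ Set.Ioo (0 : ℝ) 1, HasDerivAt (fun t => u₁ t - v₁ t) (d t) t)
    (h0 : u 0 = v 0) (h1 : u 1 = v 1)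
    (h : ∀ t ∈ Set.Ioo (0 : ℝ) 1, -M ≤ d t + (f t (u t) (u₁ t) - f t (v t) (v₁ t))) :
    ∀ t ∈ Set.Icc (0 : ℝ) 1, u t - v t ≤ M * φ t := by
  refine hφ.le_mul hM hc (fun t ht => ⟨hd t ht, hd₁ t ht⟩) (by simp [h0]) (by simp [h1])
    fun t ht hpos => ?_
  have ht' := Set.Ioo_subset_Icc_self ht
  have hx := hf.le_fst t ht' (u₁ t) (u t) (v t) (by linarith)
  have hM' := h t ht
  rcases le_total (v₁ t) (u₁ t) with hy | hy
  · have := (hf.snd t ht' (v t) _ _ hy).2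
    exact ⟨L₂, ⟨hf.le_slopes, le_rfl⟩, by linarith⟩
  · have := (hf.snd t ht' (v t) _ _ hy).1
    exact ⟨L₁, ⟨le_rfl, hf.le_slopes⟩, by linarith⟩

end OneSided

theorem abs_deriv_le_of_abs_le {w w₁ w₂ : ℝ → ℝ} {a c h : ℝ}
    (hw : ∀ t, HasDerivAt w (w₁ t) t) (hw₁ : ∀ t, HasDerivAt w₁ (w₂ t) t)
    (ha : ∀ t ∈ Set.Icc (0 : ℝ) 1, |w t| ≤ a) (hc : ∀ t ∈ Set.Icc (0 : ℝ) 1, |w₂ t| ≤ c)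
    (h0 : 0 < h) (h1 : h ≤ 1 / 2) : ∀ t ∈ Set.Icc (0 : ℝ) 1, |w₁ t| ≤ 2 * a / h + h * c := by
  have key : ∀ x ∈ Set.Icc (0 : ℝ) 1, x + h ∈ Set.Icc (0 : ℝ) 1 → ∀ t ∈ Set.Icc x (x + h),
      |w₁ t| ≤ 2 * a / h + h * c := by
    intro x hx hxh t ht
    have hsub : ∀ s ∈ Set.Icc x (x + h), s ∈ Set.Icc (0 : ℝ) 1 := fun s hs =>
      ⟨hx.1.trans hs.1, hs.2.trans hxh.2⟩
    obtain ⟨ξ, hξ, hslope⟩ := exists_hasDerivAt_eq_slope w w₁ (show x < x + h by linarith)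
      (fun s _ => (hw s).continuousAt.continuousWithinAt) fun s _ => hw s
    have hξ' := Set.Ioo_subset_Icc_self hξ
    have e1 : |w₁ ξ| ≤ 2 * a / h := by
      rw [hslope, abs_div, show x + h - x = h by ring, abs_of_pos h0]
      gcongr
      calc |w (x + h) - w x| ≤ |w (x + h)| + |w x| := abs_sub _ _
        _ ≤ 2 * a := by linarith [ha _ hx, ha _ hxh]
    have e2 : |w₁ t - w₁ ξ| ≤ c * |t - ξ| :=
      (convex_Icc x (x + h)).norm_image_sub_le_of_norm_hasDerivWithin_le
        (fun s _ => (hw₁ s).hasDerivWithinAt) (fun s hs => hc s (hsub s hs)) hξ' ht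
    have e3 : |t - ξ| ≤ h := abs_le.2 ⟨by linarith [ht.1, hξ'.2], by linarith [ht.2, hξ'.1]⟩
    have e4 : 0 ≤ c := (abs_nonneg _).trans (hc x hx)
    have e5 := abs_sub_abs_le_abs_sub (w₁ t) (w₁ ξ)
    nlinarith
  intro t ht
  rcases le_total t (1 / 2) with h2 | h2
  · exact key t ht ⟨by linarith [ht.1], by linarith⟩ t ⟨le_rfl, by linarith⟩
  · exact key (t - h) ⟨by linarith, by linarith [ht.2]⟩ (by simpa using ht) t
      ⟨by linarith, by linarith⟩

open NNReal in
theorem surjective_add_of_continuation {E : Type*} [NormedAddCommGroup E] [NormedSpace ℝ E]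
    [CompleteSpace E] {A B : E → E} {C Λ : ℝ} (hC : 0 ≤ C) (hΛ : 0 ≤ Λ)
    (hB : ∀ x y, ‖B x - B y‖ ≤ Λ * ‖x - y‖)
    (h : ∀ r ∈ Set.Icc (0 : ℝ) 1, ∀ x y, ‖x - y‖ ≤ C * ‖(A x + r • B x) - (A y + r • B y)‖)
    (hA : Function.Surjective A) : Function.Surjective fun x => A x + B x := by
  obtain ⟨N, hN⟩ := exists_nat_gt (C * Λ)
  have hN0 : (0 : ℝ) < N := (mul_nonneg hC hΛ).trans_lt hN
  have hη : C * Λ / N < 1 := by rwa [div_lt_one hN0]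
  have hη0 : 0 ≤ C * Λ / N := by positivity
  obtain ⟨κ, hκ⟩ : ∃ κ : ℝ≥0, (κ : ℝ) = C * Λ / N :=
    ⟨Real.toNNReal (C * Λ / N), Real.coe_toNNReal _ hη0⟩
  have step : ∀ i : ℕ, i ≤ N → Function.Surjective fun x => A x + ((i : ℝ) / N) • B x := by
    intro i
    induction i with
    | zero => intro _; simpa using hA
    | succ i ih =>
      intro hi y
      have hi' : (i : ℝ) / N ∈ Set.Icc (0 : ℝ) 1 :=
        ⟨by positivity, by rw [div_le_one hN0]; exact_mod_cast (Nat.le_of_succ_le hi)⟩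
      obtain ⟨S, hS⟩ := (ih (Nat.le_of_succ_le hi)).hasRightInverse
      have hS' : ∀ z, A (S z) + ((i : ℝ) / N) • B (S z) = z := hS
      have hT : ContractingWith κ fun x => S (y - (1 / (N : ℝ)) • B x) := by
        refine ⟨by rw [← NNReal.coe_lt_coe, hκ]; exact_mod_cast hη,
          LipschitzWith.of_dist_le_mul fun a b => ?_⟩
        rw [dist_eq_norm, dist_eq_norm, hκ]
        refine (h _ hi' _ _).trans ?_
        rw [hS', hS', sub_sub_sub_cancel_left, ← smul_sub, norm_smul, Real.norm_eq_abs,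
          abs_of_pos (by positivity : (0 : ℝ) < 1 / N), norm_sub_rev (B b)]
        calc C * (1 / N * ‖B a - B b‖) ≤ C * (1 / N * (Λ * ‖a - b‖)) := by gcongr; exact hB a b
          _ = C * Λ / N * ‖a - b‖ := by ring
      obtain ⟨z, hz, -⟩ := hT.exists_fixedPoint 0 (edist_ne_top _ _)
      have hfix : S (y - (1 / (N : ℝ)) • B z) = z := hz
      refine ⟨z, ?_⟩
      have := hS' (y - (1 / (N : ℝ)) • B z)
      rw [hfix] at this
      have h2 := eq_sub_iff_add_eq.1 this
      rw [← h2]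
      push_cast
      rw [add_div, add_smul, add_assoc]
  have := step N le_rfl
  rw [div_self hN0.ne'] at this
  simpa using this

section Green

/-- The extension of `q` to `ℝ` that is constant outside `[0,1]`. -/
noncomputable def lineExtend (q : C(Set.Icc (0 : ℝ) 1, ℝ)) : ℝ → ℝ := Set.IccExtend zero_le_one q

/-- The derivative of `green q`. -/
noncomputable def greenDeriv (q : C(Set.Icc (0 : ℝ) 1, ℝ)) (t : ℝ) : ℝ :=
  (∫ s in (0 : ℝ)..t, lineExtend q s) - ∫ r in (0 : ℝ)..1, ∫ s in (0 : ℝ)..r, lineExtend q s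

/-- The solution `w` of `w'' = q`, `w 0 = w 1 = 0`. -/
noncomputable def green (q : C(Set.Icc (0 : ℝ) 1, ℝ)) (t : ℝ) : ℝ :=
  ∫ s in (0 : ℝ)..t, greenDeriv q s

variable (p q : C(Set.Icc (0 : ℝ) 1, ℝ))

theorem lineExtend_apply {t : ℝ} (ht : t ∈ Set.Icc (0 : ℝ) 1) : lineExtend q t = q ⟨t, ht⟩ :=
  Set.IccExtend_of_mem _ _ ht

theorem continuous_lineExtend : Continuous (lineExtend q) := q.continuous.Icc_extend'

theorem abs_lineExtend_le (t : ℝ) : |lineExtend q t| ≤ ‖q‖ := q.norm_coe_le_norm _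

theorem lineExtend_sub (t : ℝ) : lineExtend (p - q) t = lineExtend p t - lineExtend q t := rfl

theorem hasDerivAt_primitive (t : ℝ) :
    HasDerivAt (fun t => ∫ s in (0 : ℝ)..t, lineExtend q s) (lineExtend q t) t :=
  (continuous_lineExtend q).integral_hasStrictDerivAt 0 t |>.hasDerivAt

theorem continuous_primitive : Continuous fun t => ∫ s in (0 : ℝ)..t, lineExtend q s :=
  continuous_iff_continuousAt.2 fun t => (hasDerivAt_primitive q t).continuousAt

theorem hasDerivAt_greenDeriv (t : ℝ) : HasDerivAt (greenDeriv q) (lineExtend q t) t :=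
  (hasDerivAt_primitive q t).sub_const _

theorem continuous_greenDeriv : Continuous (greenDeriv q) :=
  continuous_iff_continuousAt.2 fun t => (hasDerivAt_greenDeriv q t).continuousAt

theorem hasDerivAt_green (t : ℝ) : HasDerivAt (green q) (greenDeriv q t) t :=
  (continuous_greenDeriv q).integral_hasStrictDerivAt 0 t |>.hasDerivAt

theorem continuous_green : Continuous (green q) :=
  continuous_iff_continuousAt.2 fun t => (hasDerivAt_green q t).continuousAt

@[simp] theorem green_zero : green q 0 = 0 := by simp [green]

@[simp] theorem green_one : green q 1 = 0 := by
  have := (continuous_primitive q).intervalIntegrable (μ := volume) 0 1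
  simp [green, greenDeriv, intervalIntegral.integral_sub this]

theorem greenDeriv_sub (t : ℝ) : greenDeriv (p - q) t = greenDeriv p t - greenDeriv q t := by
  have h (t : ℝ) : ∫ s in (0 : ℝ)..t, lineExtend (p - q) s =
      (∫ s in (0 : ℝ)..t, lineExtend p s) - ∫ s in (0 : ℝ)..t, lineExtend q s :=
    intervalIntegral.integral_sub ((continuous_lineExtend p).intervalIntegrable _ _)
      ((continuous_lineExtend q).intervalIntegrable _ _)
  simp only [greenDeriv, h]
  rw [intervalIntegral.integral_sub ((continuous_primitive p).intervalIntegrable _ _)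
    ((continuous_primitive q).intervalIntegrable _ _)]
  ring

theorem green_sub (t : ℝ) : green (p - q) t = green p t - green q t := by
  simp only [green, greenDeriv_sub]
  exact intervalIntegral.integral_sub ((continuous_greenDeriv p).intervalIntegrable _ _)
    ((continuous_greenDeriv q).intervalIntegrable _ _)

theorem abs_integral_le_of_abs_le {g : ℝ → ℝ} {c t : ℝ} (ht : t ∈ Set.Icc (0 : ℝ) 1)
    (hg : ∀ s ∈ Set.Icc (0 : ℝ) 1, |g s| ≤ c) : |∫ s in (0 : ℝ)..t, g s| ≤ c := by
  have hc : 0 ≤ c := (abs_nonneg _).trans (hg 0 (by simp))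
  have := intervalIntegral.norm_integral_le_of_norm_le_const (a := 0) (b := t) (f := g) (C := c)
    fun s hs => by
      rw [Set.uIoc_of_le ht.1] at hs
      exact hg s ⟨hs.1.le, hs.2.trans ht.2⟩
  rw [sub_zero, abs_of_nonneg ht.1] at this
  exact this.trans (mul_le_of_le_one_right hc ht.2)

theorem abs_greenDeriv_le {t : ℝ} (ht : t ∈ Set.Icc (0 : ℝ) 1) :
    |greenDeriv q t| ≤ 2 * ‖q‖ := by
  have h : ∀ t ∈ Set.Icc (0 : ℝ) 1, |∫ s in (0 : ℝ)..t, lineExtend q s| ≤ ‖q‖ := fun t ht =>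
    abs_integral_le_of_abs_le ht fun s _ => abs_lineExtend_le q s
  have h2 := abs_integral_le_of_abs_le (t := 1) (by simp) h
  have h3 := abs_sub (∫ s in (0 : ℝ)..t, lineExtend q s)
    (∫ r in (0 : ℝ)..1, ∫ s in (0 : ℝ)..r, lineExtend q s)
  unfold greenDeriv
  linarith [h t ht]

theorem abs_green_le {t : ℝ} (ht : t ∈ Set.Icc (0 : ℝ) 1) : |green q t| ≤ 2 * ‖q‖ :=
  abs_integral_le_of_abs_le ht fun _ hs => abs_greenDeriv_le q hs

/-- The map `q ↦ q + k(·, w, w')` with `w = green q`. -/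
noncomputable def bvpResidual (k : ℝ → ℝ → ℝ → ℝ)
    (hk : Continuous fun p : ℝ × ℝ × ℝ => k p.1 p.2.1 p.2.2) (q : C(Set.Icc (0 : ℝ) 1, ℝ)) :
    C(Set.Icc (0 : ℝ) 1, ℝ) where
  toFun t := q t + k t (green q t) (greenDeriv q t)
  continuous_toFun := q.continuous.add (hk.comp (continuous_subtype_val.prodMk
    (((continuous_green q).comp continuous_subtype_val).prodMk
      ((continuous_greenDeriv q).comp continuous_subtype_val))))

end Green

section Estimates

variable {L₁ L₂ K Φ Λ : ℝ} {φ : ℝ → ℝ} {k : ℝ → ℝ → ℝ → ℝ}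
  {hk : Continuous fun p : ℝ × ℝ × ℝ => k p.1 p.2.1 p.2.2}

theorem bvpResidual_apply (q : C(Set.Icc (0 : ℝ) 1, ℝ)) {t : ℝ} (ht : t ∈ Set.Icc (0 : ℝ) 1) :
    bvpResidual k hk q ⟨t, ht⟩ = lineExtend q t + k t (green q t) (greenDeriv q t) := by
  rw [lineExtend_apply q ht]; rfl

theorem OneSided.green_sub_le (hf : OneSided L₁ L₂ K k) (hφ : IsBarrier L₁ L₂ K φ)
    (hΦ : ∀ t ∈ Set.Icc (0 : ℝ) 1, φ t ≤ Φ) (p q : C(Set.Icc (0 : ℝ) 1, ℝ)) {t : ℝ}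
    (ht : t ∈ Set.Icc (0 : ℝ) 1) :
    green p t - green q t ≤ ‖bvpResidual k hk p - bvpResidual k hk q‖ * Φ := by
  refine (hf.sub_le_mul (M := ‖bvpResidual k hk p - bvpResidual k hk q‖) hφ (norm_nonneg _)
    ((continuous_green p).sub (continuous_green q)).continuousOn
    (fun t _ => (hasDerivAt_green p t).sub (hasDerivAt_green q t))
    (fun t _ => (hasDerivAt_greenDeriv p t).sub (hasDerivAt_greenDeriv q t))
    (by simp) (by simp) (fun s hs => ?_) t ht).trans
    (mul_le_mul_of_nonneg_left (hΦ t ht) (norm_nonneg _))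
  have hs' := Set.Ioo_subset_Icc_self hs
  have := (abs_le.1 ((bvpResidual k hk p - bvpResidual k hk q).norm_coe_le_norm ⟨s, hs'⟩)).1
  rw [ContinuousMap.sub_apply, bvpResidual_apply, bvpResidual_apply] at this
  linarith

theorem OneSided.abs_green_sub_le (hf : OneSided L₁ L₂ K k) (hφ : IsBarrier L₁ L₂ K φ)
    (hΦ : ∀ t ∈ Set.Icc (0 : ℝ) 1, φ t ≤ Φ) (p q : C(Set.Icc (0 : ℝ) 1, ℝ)) {t : ℝ}
    (ht : t ∈ Set.Icc (0 : ℝ) 1) :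
    |green p t - green q t| ≤ ‖bvpResidual k hk p - bvpResidual k hk q‖ * Φ := by
  rw [abs_sub_le_iff]
  refine ⟨hf.green_sub_le hφ hΦ p q ht, ?_⟩
  rw [norm_sub_rev]
  exact hf.green_sub_le hφ hΦ q p ht

theorem abs_greenDeriv_sub_le {p q : C(Set.Icc (0 : ℝ) 1, ℝ)} {a h : ℝ}
    (ha : ∀ t ∈ Set.Icc (0 : ℝ) 1, |green p t - green q t| ≤ a) (h0 : 0 < h) (h1 : h ≤ 1 / 2)
    {t : ℝ} (ht : t ∈ Set.Icc (0 : ℝ) 1) :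
    |greenDeriv p t - greenDeriv q t| ≤ 2 * a / h + h * ‖p - q‖ := by
  rw [← greenDeriv_sub]
  exact abs_deriv_le_of_abs_le (hasDerivAt_green _) (hasDerivAt_greenDeriv _)
    (fun s hs => by rw [green_sub]; exact ha s hs) (fun s _ => abs_lineExtend_le _ s) h0 h1 t ht

theorem OneSided.norm_sub_le_of_lipschitz (hf : OneSided L₁ L₂ K k) (hφ : IsBarrier L₁ L₂ K φ)
    (hΦ : ∀ t ∈ Set.Icc (0 : ℝ) 1, φ t ≤ Φ) (hΛ : 0 ≤ Λ)
    (hlip : ∀ t ∈ Set.Icc (0 : ℝ) 1, ∀ x x' y y',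
      |k t x y - k t x' y'| ≤ Λ * (|x - x'| + |y - y'|)) (p q : C(Set.Icc (0 : ℝ) 1, ℝ)) :
    ‖p - q‖ ≤ 2 * (1 + Λ * Φ + Λ * (4 * (Λ + 1) * Φ)) *
      ‖bvpResidual k hk p - bvpResidual k hk q‖ := by
  obtain ⟨δ, hδ⟩ : ∃ δ, δ = ‖bvpResidual k hk p - bvpResidual k hk q‖ := ⟨_, rfl⟩
  have hΦ0 : 0 ≤ Φ := (hφ.pos 0 (by simp)).le.trans (hΦ 0 (by simp))
  have hδ0 : 0 ≤ δ := hδ ▸ norm_nonneg _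
  have hw : ∀ t ∈ Set.Icc (0 : ℝ) 1, |green p t - green q t| ≤ δ * Φ := fun t ht =>
    hδ ▸ hf.abs_green_sub_le hφ hΦ p q ht
  have hh : 1 / (2 * (Λ + 1)) ≤ 1 / 2 := by
    apply one_div_le_one_div_of_le two_pos; linarith
  have hmain : ‖p - q‖ ≤ δ + Λ * (δ * Φ + (4 * (Λ + 1) * (δ * Φ) + ‖p - q‖ / (2 * (Λ + 1)))) := by
    rw [ContinuousMap.norm_le _ (by positivity)]
    rintro ⟨t, ht⟩
    have h1 := abs_greenDeriv_sub_le hw (by positivity) hh ht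
    have h1' : 2 * (δ * Φ) / (1 / (2 * (Λ + 1))) + 1 / (2 * (Λ + 1)) * ‖p - q‖ =
      4 * (Λ + 1) * (δ * Φ) + ‖p - q‖ / (2 * (Λ + 1)) := by field_simp; ring
    rw [h1'] at h1
    have h2 := hlip t ht (green p t) (green q t) (greenDeriv p t) (greenDeriv q t)
    have h3 := (bvpResidual k hk p - bvpResidual k hk q).norm_coe_le_norm ⟨t, ht⟩
    rw [ContinuousMap.sub_apply, bvpResidual_apply, bvpResidual_apply, ← hδ,
      Real.norm_eq_abs] at h3
    have h4 := mul_le_mul_of_nonneg_left (add_le_add (hw t ht) h1) hΛ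
    rw [Real.norm_eq_abs, ContinuousMap.sub_apply, ← lineExtend_apply p ht,
      ← lineExtend_apply q ht]
    rw [abs_le] at h2 h3 ⊢
    constructor <;> linarith [h2.1, h2.2, h3.1, h3.2]
  have hle : Λ * (‖p - q‖ / (2 * (Λ + 1))) ≤ ‖p - q‖ / 2 := by
    rw [mul_div_assoc', div_le_div_iff₀ (by positivity) two_pos]
    nlinarith [norm_nonneg (p - q)]
  rw [← hδ]
  nlinarith

theorem surjective_bvpResidual_of_segment {k₀ k₁ : ℝ → ℝ → ℝ → ℝ}
    (hk₀ : Continuous fun p : ℝ × ℝ × ℝ => k₀ p.1 p.2.1 p.2.2)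
    (hk₁ : Continuous fun p : ℝ × ℝ × ℝ => k₁ p.1 p.2.1 p.2.2)
    (hf₀ : OneSided L₁ L₂ K k₀) (hf₁ : OneSided L₁ L₂ K k₁) (hφ : IsBarrier L₁ L₂ K φ)
    (hΛ : 0 ≤ Λ)
    (hlip₀ : ∀ t ∈ Set.Icc (0 : ℝ) 1, ∀ x x' y y',
      |k₀ t x y - k₀ t x' y'| ≤ Λ * (|x - x'| + |y - y'|))
    (hlip₁ : ∀ t ∈ Set.Icc (0 : ℝ) 1, ∀ x x' y y',
      |k₁ t x y - k₁ t x' y'| ≤ Λ * (|x - x'| + |y - y'|))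
    (hsurj : Function.Surjective (bvpResidual k₀ hk₀)) :
    Function.Surjective (bvpResidual k₁ hk₁) := by
  obtain ⟨Φ, hΦ⟩ := (isCompact_Icc.bddAbove_image hφ.continuousOn)
  replace hΦ : ∀ t ∈ Set.Icc (0 : ℝ) 1, φ t ≤ Φ := fun t ht => hΦ ⟨t, ht, rfl⟩
  have hΦ0 : 0 ≤ Φ := (hφ.pos 0 (by simp)).le.trans (hΦ 0 (by simp))
  have hkr : ∀ r : ℝ, Continuous fun p : ℝ × ℝ × ℝ =>
      k₀ p.1 p.2.1 p.2.2 + r * (k₁ p.1 p.2.1 p.2.2 - k₀ p.1 p.2.1 p.2.2) := fun r =>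
    hk₀.add (continuous_const.mul (hk₁.sub hk₀))
  have hres : ∀ (r : ℝ) (q : C(Set.Icc (0 : ℝ) 1, ℝ)),
      bvpResidual k₀ hk₀ q + r • (bvpResidual k₁ hk₁ q - bvpResidual k₀ hk₀ q) =
      bvpResidual (fun t x y => k₀ t x y + r * (k₁ t x y - k₀ t x y)) (hkr r) q := by
    intro r q
    ext ⟨t, ht⟩
    simp only [ContinuousMap.add_apply, ContinuousMap.smul_apply, ContinuousMap.sub_apply,
      bvpResidual_apply, smul_eq_mul]
    ring
  have := surjective_add_of_continuation (A := bvpResidual k₀ hk₀)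
    (B := fun q => bvpResidual k₁ hk₁ q - bvpResidual k₀ hk₀ q)
    (C := 2 * (1 + Λ * Φ + Λ * (4 * (Λ + 1) * Φ))) (Λ := 2 * Λ * 4) (by positivity)
    (by positivity) (fun p q => ?_) (fun r hr p q => ?_) hsurj
  · simpa using this
  · rw [ContinuousMap.norm_le _ (by positivity)]
    rintro ⟨t, ht⟩
    have h1 : |green p t - green q t| ≤ 2 * ‖p - q‖ := by
      rw [← green_sub]; exact abs_green_le _ ht
    have h2 : |greenDeriv p t - greenDeriv q t| ≤ 2 * ‖p - q‖ := by
      rw [← greenDeriv_sub]; exact abs_greenDeriv_le _ ht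
    have h3 := hlip₀ t ht (green p t) (green q t) (greenDeriv p t) (greenDeriv q t)
    have h4 := hlip₁ t ht (green p t) (green q t) (greenDeriv p t) (greenDeriv q t)
    have h5 := mul_le_mul_of_nonneg_left (add_le_add h1 h2) hΛ
    simp only [ContinuousMap.sub_apply, bvpResidual_apply, Real.norm_eq_abs]
    rw [abs_le] at h3 h4 ⊢
    constructor <;> linarith [h3.1, h3.2, h4.1, h4.2]
  · rw [hres, hres]
    refine (hf₀.combo hf₁ hr).norm_sub_le_of_lipschitz hφ hΦ hΛ (fun t ht x x' y y' => ?_) p q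
    have h3 := hlip₀ t ht x x' y y'
    have h4 := hlip₁ t ht x x' y y'
    have h5 : 0 ≤ 1 - r := by linarith [hr.2]
    calc |k₀ t x y + r * (k₁ t x y - k₀ t x y) - (k₀ t x' y' + r * (k₁ t x' y' - k₀ t x' y'))|
        = |(1 - r) * (k₀ t x y - k₀ t x' y') + r * (k₁ t x y - k₁ t x' y')| := by ring_nf
      _ ≤ (1 - r) * |k₀ t x y - k₀ t x' y'| + r * |k₁ t x y - k₁ t x' y'| := by
          refine (abs_add_le _ _).trans_eq ?_
          rw [abs_mul, abs_mul, abs_of_nonneg h5, abs_of_nonneg hr.1]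
      _ ≤ (1 - r) * (Λ * (|x - x'| + |y - y'|)) + r * (Λ * (|x - x'| + |y - y'|)) :=
          add_le_add (mul_le_mul_of_nonneg_left h3 h5) (mul_le_mul_of_nonneg_left h4 hr.1)
      _ = Λ * (|x - x'| + |y - y'|) := by ring

theorem OneSided.surjective_of_lipschitz (hf : OneSided L₁ L₂ K k) (hK : 0 ≤ K)
    (hφ : IsBarrier L₁ L₂ K φ) (hΛ : 0 ≤ Λ)
    (hlip : ∀ t ∈ Set.Icc (0 : ℝ) 1, ∀ x x' y y',
      |k t x y - k t x' y'| ≤ Λ * (|x - x'| + |y - y'|)) :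
    Function.Surjective (bvpResidual k hk) := by
  obtain ⟨ψ, hψ⟩ := exists_barrier (L₁ := -|L₁|) (L₂ := |L₁|) (K := 0) le_rfl (by
    rw [betaBSW, alphaBSW_of_nonpos _ le_rfl, alphaBSW_of_nonpos _ le_rfl]
    simpa using EReal.coe_lt_top 1)
  have hc : Continuous fun p : ℝ × ℝ × ℝ => L₁ * p.2.2 := by fun_prop
  have hlin : ∀ t ∈ Set.Icc (0 : ℝ) 1, ∀ x x' y y' : ℝ,
      |L₁ * y - L₁ * y'| ≤ |L₁| * (|x - x'| + |y - y'|) := by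
    intro t _ x x' y y'
    rw [← mul_sub, abs_mul]
    exact mul_le_mul_of_nonneg_left (by linarith [abs_nonneg (x - x')]) (abs_nonneg _)
  have h1 : Function.Surjective (bvpResidual (fun _ _ y => L₁ * y) hc) := by
    refine surjective_bvpResidual_of_segment (k₀ := fun _ _ _ => 0) continuous_const hc
      ⟨fun _ _ _ _ _ _ => by simp, fun _ _ _ y y' hy => ?_⟩
      ⟨fun _ _ _ _ _ _ => by simp, fun _ _ _ y y' hy => ?_⟩ hψ (abs_nonneg L₁)
      (fun t _ x x' y y' => by simp; positivity) hlin fun q => ⟨q, ?_⟩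
    · have := mul_nonneg (abs_nonneg L₁) (sub_nonneg.2 hy)
      constructor <;> linarith
    · have h2 := mul_le_mul_of_nonneg_right (neg_abs_le L₁) (sub_nonneg.2 hy)
      have h3 := mul_le_mul_of_nonneg_right (le_abs_self L₁) (sub_nonneg.2 hy)
      constructor <;> linarith
    · ext ⟨t, ht⟩
      simp [bvpResidual]
  refine surjective_bvpResidual_of_segment (Λ := |L₁| + Λ) hc hk
    ⟨fun _ _ _ x x' hx => ?_, fun _ _ _ y y' hy => ?_⟩ hf hφ (by positivity)
    (fun t ht x x' y y' => (hlin t ht x x' y y').trans ?_)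
    (fun t ht x x' y y' => (hlip t ht x x' y y').trans ?_) h1
  · simpa using mul_nonneg hK (sub_nonneg.2 hx)
  · have := mul_le_mul_of_nonneg_right hf.le_slopes (sub_nonneg.2 hy)
    constructor <;> linarith
  · exact mul_le_mul_of_nonneg_right (by linarith) (by positivity)
  · exact mul_le_mul_of_nonneg_right (by linarith [abs_nonneg L₁]) (by positivity)

end Estimates

section Steklov

/-- The average of `k t · y` over `[x, x + h]`. -/
noncomputable def steklov (k : ℝ → ℝ → ℝ → ℝ) (h t x y : ℝ) : ℝ :=
  ∫ s in (0 : ℝ)..1, k t (x + h * s) y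

variable {L₁ L₂ K B h : ℝ} {k : ℝ → ℝ → ℝ → ℝ}

theorem continuous_steklov (hk : Continuous fun p : ℝ × ℝ × ℝ => k p.1 p.2.1 p.2.2) :
    Continuous fun p : ℝ × ℝ × ℝ => steklov k h p.1 p.2.1 p.2.2 := by
  unfold steklov
  refine intervalIntegral.continuous_parametric_intervalIntegral_of_continuous' ?_ 0 1
  exact hk.comp (by fun_prop : Continuous fun z : (ℝ × ℝ × ℝ) × ℝ =>
    (z.1.1, z.1.2.1 + h * z.2, z.1.2.2))

theorem continuous_section (hk : Continuous fun p : ℝ × ℝ × ℝ => k p.1 p.2.1 p.2.2) (t y : ℝ) :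
    Continuous fun x => k t x y :=
  hk.comp (by fun_prop : Continuous fun x : ℝ => (t, x, y))

theorem intervalIntegrable_shift (hk : Continuous fun p : ℝ × ℝ × ℝ => k p.1 p.2.1 p.2.2)
    (t x y : ℝ) : IntervalIntegrable (fun s => k t (x + h * s) y) volume 0 1 :=
  ((continuous_section hk t y).comp (by fun_prop : Continuous fun s => x + h * s)
    ).intervalIntegrable _ _

theorem OneSided.steklov_average (hf : OneSided L₁ L₂ K k)
    (hk : Continuous fun p : ℝ × ℝ × ℝ => k p.1 p.2.1 p.2.2) :
    OneSided L₁ L₂ K (steklov k h) := by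
  have hconst : ∀ c : ℝ, c = ∫ _ in (0 : ℝ)..1, c := fun c => by simp
  refine ⟨fun t ht y x x' hx => ?_, fun t ht x y y' hy => ?_⟩
  · have h1 := intervalIntegrable_shift (h := h) hk t x y
    have h2 := intervalIntegrable_shift (h := h) hk t x' y
    rw [steklov, steklov, ← intervalIntegral.integral_sub h1 h2,
      hconst (K * (x - x'))]
    refine intervalIntegral.integral_mono zero_le_one (h1.sub h2) (by simp) fun s => ?_
    have := hf.le_fst t ht y (x + h * s) (x' + h * s) (by linarith)
    simpa using this
  · have h1 := intervalIntegrable_shift (h := h) hk t x y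
    have h2 := intervalIntegrable_shift (h := h) hk t x y'
    rw [steklov, steklov, ← intervalIntegral.integral_sub h1 h2,
      hconst (L₁ * (y - y')), hconst (L₂ * (y - y'))]
    exact ⟨intervalIntegral.integral_mono zero_le_one (by simp) (h1.sub h2)
      fun s => (hf.snd t ht (x + h * s) y y' hy).1,
      intervalIntegral.integral_mono zero_le_one (h1.sub h2) (by simp)
      fun s => (hf.snd t ht (x + h * s) y y' hy).2⟩

theorem OneSided.abs_sub_snd_le (hf : OneSided L₁ L₂ K k) {t : ℝ} (ht : t ∈ Set.Icc (0 : ℝ) 1)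
    (x y y' : ℝ) : |k t x y - k t x y'| ≤ (|L₁| + |L₂|) * |y - y'| := by
  wlog hy : y' ≤ y generalizing y y'
  · rw [abs_sub_comm, abs_sub_comm y]
    exact this y' y (le_of_not_ge hy)
  obtain ⟨h1, h2⟩ := hf.snd t ht x y y' hy
  have h0 := sub_nonneg.2 hy
  rw [abs_of_nonneg h0, abs_le]
  have h3 := mul_le_mul_of_nonneg_right (neg_abs_le L₁) h0
  have h4 := mul_le_mul_of_nonneg_right (le_abs_self L₂) h0
  have h5 := mul_nonneg (abs_nonneg L₁) h0
  have h6 := mul_nonneg (abs_nonneg L₂) h0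
  constructor <;> linarith

theorem abs_steklov_sub_le_fst (hk : Continuous fun p : ℝ × ℝ × ℝ => k p.1 p.2.1 p.2.2)
    (hh : 0 < h) {t y : ℝ} (hB : ∀ x x', |k t x y - k t x' y| ≤ B) (x x' : ℝ) :
    |steklov k h t x y - steklov k h t x' y| ≤ B / h * |x - x'| := by
  have hc := continuous_section hk t y
  have hi : ∀ a b, IntervalIntegrable (fun z => k t z y) volume a b := fun a b =>
    hc.intervalIntegrable _ _
  have hi' : IntervalIntegrable (fun z => k t (z + h) y) volume x x' :=
    (hc.comp (continuous_add_const h)).intervalIntegrable _ _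
  have hform : ∀ x, steklov k h t x y = h⁻¹ * ∫ z in x..x + h, k t z y := fun x => by
    have := intervalIntegral.integral_comp_add_mul (a := 0) (b := 1) (fun z => k t z y) hh.ne' x
    simpa [steklov] using this
  rw [hform, hform, ← mul_sub, abs_mul, abs_of_pos (inv_pos.2 hh),
    intervalIntegral.integral_interval_sub_interval_comm (hi _ _) (hi _ _) (hi _ _),
    ← intervalIntegral.integral_comp_add_right (fun z => k t z y),
    ← intervalIntegral.integral_sub (hi _ _) hi']
  have := intervalIntegral.norm_integral_le_of_norm_le_const (a := x) (b := x')
    (f := fun z => k t z y - k t (z + h) y) (C := B) fun z _ => hB _ _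
  rw [abs_sub_comm x, div_mul_eq_mul_div, div_eq_inv_mul]
  exact mul_le_mul_of_nonneg_left this (inv_pos.2 hh).le

theorem abs_steklov_sub_self_le (hk : Continuous fun p : ℝ × ℝ × ℝ => k p.1 p.2.1 p.2.2)
    (hh : 0 < h) {t x y ε : ℝ} (hε : ∀ x', |x' - x| ≤ h → |k t x' y - k t x y| ≤ ε) :
    |steklov k h t x y - k t x y| ≤ ε := by
  have : k t x y = ∫ _ in (0 : ℝ)..1, k t x y := by simp
  rw [this, steklov, ← intervalIntegral.integral_sub (intervalIntegrable_shift hk t x y) (by simp)]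
  refine abs_integral_le_of_abs_le (by simp) fun s hs => hε _ ?_
  rw [add_sub_cancel_left, abs_mul, abs_of_pos hh, abs_of_nonneg hs.1]
  exact mul_le_of_le_one_right hh.le hs.2

end Steklov

section Existence

variable {L₁ L₂ K Φ B : ℝ} {φ : ℝ → ℝ} {k : ℝ → ℝ → ℝ → ℝ}
  {hk : Continuous fun p : ℝ × ℝ × ℝ => k p.1 p.2.1 p.2.2}

theorem OneSided.exists_norm_bvpResidual_le (hf : OneSided L₁ L₂ K k) (hK : 0 ≤ K)
    (hφ : IsBarrier L₁ L₂ K φ)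
    (hB : ∀ t ∈ Set.Icc (0 : ℝ) 1, ∀ x x' y, |k t x y - k t x' y| ≤ B)
    (huc : ∀ ε > 0, ∃ δ > 0, ∀ t ∈ Set.Icc (0 : ℝ) 1, ∀ x x' y y', |x - x'| ≤ δ → |y - y'| ≤ δ →
      |k t x y - k t x' y'| ≤ ε) {ε : ℝ} (hε : 0 < ε) :
    ∃ q, ‖bvpResidual k hk q‖ ≤ ε := by
  obtain ⟨h, hh, hclose⟩ := huc ε hε
  have hB0 : 0 ≤ B := (abs_nonneg _).trans (hB 0 (by simp) 0 0 0)
  have hf' : OneSided L₁ L₂ K (steklov k h) := hf.steklov_average hk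
  have hlip : ∀ t ∈ Set.Icc (0 : ℝ) 1, ∀ x x' y y',
      |steklov k h t x y - steklov k h t x' y'| ≤
        (B / h + (|L₁| + |L₂|)) * (|x - x'| + |y - y'|) := by
    intro t ht x x' y y'
    have h1 := abs_steklov_sub_le_fst hk hh (fun x x' => hB t ht x x' y) x x'
    have h2 := hf'.abs_sub_snd_le ht x' y y'
    have h3 := abs_sub_le (steklov k h t x y) (steklov k h t x' y)
      (steklov k h t x' y')
    have h4 : 0 ≤ B / h * |y - y'| := by positivity
    have h5 : 0 ≤ (|L₁| + |L₂|) * |x - x'| := by positivity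
    linarith
  obtain ⟨q, hq⟩ := hf'.surjective_of_lipschitz (hk := continuous_steklov hk) hK hφ
    (by positivity) hlip 0
  refine ⟨q, ?_⟩
  rw [ContinuousMap.norm_le _ hε.le]
  rintro ⟨t, ht⟩
  have h1 := DFunLike.congr_fun hq ⟨t, ht⟩
  rw [bvpResidual_apply, ContinuousMap.zero_apply] at h1
  rw [bvpResidual_apply, Real.norm_eq_abs, eq_neg_of_add_eq_zero_left h1, neg_add_eq_sub,
    abs_sub_comm]
  exact abs_steklov_sub_self_le hk hh fun x' hx' => hclose t ht _ _ _ _ hx' (by simp [hh.le])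

theorem OneSided.exists_norm_le (hf : OneSided L₁ L₂ K k) (hφ : IsBarrier L₁ L₂ K φ)
    (hΦ : ∀ t ∈ Set.Icc (0 : ℝ) 1, φ t ≤ Φ)
    (hB : ∀ t ∈ Set.Icc (0 : ℝ) 1, ∀ x x' y, |k t x y - k t x' y| ≤ B) :
    ∃ C, ∀ q, ‖bvpResidual k hk q‖ ≤ 1 → ‖q‖ ≤ C := by
  obtain ⟨Λ, hΛ⟩ : ∃ Λ, Λ = |L₁| + |L₂| := ⟨_, rfl⟩
  have hΛ0 : 0 ≤ Λ := by rw [hΛ]; positivity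
  have hΦ0 : 0 ≤ Φ := (hφ.pos 0 (by simp)).le.trans (hΦ 0 (by simp))
  have hB0 : 0 ≤ B := (abs_nonneg _).trans (hB 0 (by simp) 0 0 0)
  obtain ⟨m, hm⟩ : ∃ m, m = ‖bvpResidual k hk 0‖ := ⟨_, rfl⟩
  have hm0 : 0 ≤ m := hm ▸ norm_nonneg _
  have g0 : ∀ t, green 0 t = 0 := fun t => by simpa using green_sub 0 0 t
  have g1 : ∀ t, greenDeriv 0 t = 0 := fun t => by simpa using greenDeriv_sub 0 0 t
  have e0 : ∀ t, lineExtend 0 t = 0 := fun t => by simpa using lineExtend_sub 0 0 t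
  have hh : 1 / (2 * (Λ + 1)) ≤ 1 / 2 := by
    apply one_div_le_one_div_of_le two_pos; linarith
  refine ⟨2 * (1 + m + B + Λ * (4 * (Λ + 1) * ((1 + m) * Φ))), fun q hq => ?_⟩
  have hw : ∀ t ∈ Set.Icc (0 : ℝ) 1, |green q t - green 0 t| ≤ (1 + m) * Φ := fun t ht => by
    refine (hf.abs_green_sub_le (hk := hk) hφ hΦ q 0 ht).trans
      (mul_le_mul_of_nonneg_right ?_ hΦ0)
    rw [hm]
    exact (norm_sub_le _ _).trans (by linarith)
  have hmain : ‖q‖ ≤ 1 + (m + B +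
      Λ * (4 * (Λ + 1) * ((1 + m) * Φ) + ‖q‖ / (2 * (Λ + 1)))) := by
    rw [ContinuousMap.norm_le _ (by positivity)]
    rintro ⟨t, ht⟩
    have h1 := abs_greenDeriv_sub_le hw (by positivity) hh ht
    have h1' : 2 * ((1 + m) * Φ) / (1 / (2 * (Λ + 1))) + 1 / (2 * (Λ + 1)) * ‖q - 0‖ =
      4 * (Λ + 1) * ((1 + m) * Φ) + ‖q‖ / (2 * (Λ + 1)) := by rw [sub_zero]; field_simp; ring
    rw [h1', g1, sub_zero] at h1
    have h2 := hf.abs_sub_snd_le ht (green q t) (greenDeriv q t) 0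
    have h3 := ((bvpResidual k hk q).norm_coe_le_norm ⟨t, ht⟩).trans hq
    have h5 := hB t ht (green q t) 0 0
    have h6 := (bvpResidual k hk 0).norm_coe_le_norm ⟨t, ht⟩
    rw [bvpResidual_apply, ← hm, g0, g1, e0, zero_add, Real.norm_eq_abs] at h6
    rw [bvpResidual_apply, Real.norm_eq_abs] at h3
    have h4 := mul_le_mul_of_nonneg_left h1 hΛ0
    rw [sub_zero, ← hΛ] at h2
    rw [Real.norm_eq_abs, ← lineExtend_apply q ht]
    rw [abs_le] at h2 h3 h5 h6 ⊢
    constructor <;> linarith [h2.1, h2.2, h3.1, h3.2, h5.1, h5.2, h6.1, h6.2]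
  have hle : Λ * (‖q‖ / (2 * (Λ + 1))) ≤ ‖q‖ / 2 := by
    rw [mul_div_assoc', div_le_div_iff₀ (by positivity) two_pos]
    nlinarith [norm_nonneg q]
  linarith

theorem OneSided.norm_sub_le_of_norm_bvpResidual_le (hf : OneSided L₁ L₂ K k)
    (hφ : IsBarrier L₁ L₂ K φ) (hΦ : ∀ t ∈ Set.Icc (0 : ℝ) 1, φ t ≤ Φ)
    (hB : ∀ t ∈ Set.Icc (0 : ℝ) 1, ∀ x x' y, |k t x y - k t x' y| ≤ B)
    (huc : ∀ ε > 0, ∃ δ > 0, ∀ t ∈ Set.Icc (0 : ℝ) 1, ∀ x x' y y', |x - x'| ≤ δ → |y - y'| ≤ δ →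
      |k t x y - k t x' y'| ≤ ε) {ε : ℝ} (hε : 0 < ε) :
    ∃ δ > 0, ∀ p q, ‖bvpResidual k hk p‖ ≤ δ → ‖bvpResidual k hk q‖ ≤ δ → ‖p - q‖ ≤ ε := by
  have hΦ0 : 0 < Φ := (hφ.pos 0 (by simp)).trans_le (hΦ 0 (by simp))
  obtain ⟨C, hC⟩ := hf.exists_norm_le (hk := hk) hφ hΦ hB
  obtain ⟨η, hη, hclose⟩ := huc (ε / 2) (half_pos hε)
  obtain ⟨D, hD⟩ : ∃ D, D = |C| + 1 := ⟨_, rfl⟩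
  have hD0 : 0 < D := by rw [hD]; positivity
  have hCD : C ≤ D := by rw [hD]; linarith [le_abs_self C]
  obtain ⟨h, hh⟩ : ∃ h, h = min (1 / 2) (η / (4 * D)) := ⟨_, rfl⟩
  have hh0 : 0 < h := by rw [hh]; positivity
  have hh1 : h ≤ 1 / 2 := by rw [hh]; exact min_le_left _ _
  have hh2 : h * (2 * D) ≤ η / 2 := by
    have : h ≤ η / (4 * D) := by rw [hh]; exact min_le_right _ _
    rw [le_div_iff₀ (by positivity)] at this
    linarith
  obtain ⟨δ, hδ⟩ : ∃ δ, δ = min 1 (min (ε / 4) (η * h / (8 * Φ))) := ⟨_, rfl⟩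
  have hδ0 : 0 < δ := by rw [hδ]; positivity
  have hδ1 : δ ≤ 1 := by rw [hδ]; exact min_le_left _ _
  have hδ2 : δ ≤ ε / 4 := by rw [hδ]; exact (min_le_right _ _).trans (min_le_left _ _)
  have hδ3 : δ * (8 * Φ) ≤ η * h := by
    rw [← le_div_iff₀ (by positivity), hδ]; exact (min_le_right _ _).trans (min_le_right _ _)
  refine ⟨δ, hδ0, fun p q hp hq => ?_⟩
  have hpC := hC p (hp.trans hδ1)
  have hqC := hC q (hq.trans hδ1)
  have hpq : ‖p - q‖ ≤ 2 * D := (norm_sub_le _ _).trans (by linarith)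
  have hw : ∀ t ∈ Set.Icc (0 : ℝ) 1, |green p t - green q t| ≤ 2 * δ * Φ := fun t ht =>
    (hf.abs_green_sub_le (hk := hk) hφ hΦ p q ht).trans (mul_le_mul_of_nonneg_right
      ((norm_sub_le _ _).trans (by linarith)) hΦ0.le)
  rw [ContinuousMap.norm_le _ hε.le]
  rintro ⟨t, ht⟩
  have h1 := abs_greenDeriv_sub_le hw hh0 hh1 ht
  have h2 : 2 * (2 * δ * Φ) / h ≤ η / 2 := by
    rw [div_le_iff₀ hh0]; linarith
  have h3 := mul_le_mul_of_nonneg_left hpq hh0.le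
  have h4 : 2 * δ * Φ ≤ η := by nlinarith
  have h5 := hclose t ht (green p t) (green q t) (greenDeriv p t) (greenDeriv q t)
    ((hw t ht).trans h4) (by linarith)
  have h6 := ((bvpResidual k hk p).norm_coe_le_norm ⟨t, ht⟩).trans (hp.trans hδ2)
  have h7 := ((bvpResidual k hk q).norm_coe_le_norm ⟨t, ht⟩).trans (hq.trans hδ2)
  rw [bvpResidual_apply, Real.norm_eq_abs] at h6 h7
  rw [Real.norm_eq_abs, ContinuousMap.sub_apply, ← lineExtend_apply p ht,
    ← lineExtend_apply q ht]
  rw [abs_le] at h5 h6 h7 ⊢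
  constructor <;> linarith [h5.1, h5.2, h6.1, h6.2, h7.1, h7.2]

theorem continuous_green_apply {t : ℝ} (ht : t ∈ Set.Icc (0 : ℝ) 1) :
    Continuous fun q => green q t :=
  LipschitzWith.continuous (K := 2) <| LipschitzWith.of_dist_le_mul fun p q => by
    rw [Real.dist_eq, ← green_sub, dist_eq_norm]
    exact abs_green_le _ ht

theorem continuous_greenDeriv_apply {t : ℝ} (ht : t ∈ Set.Icc (0 : ℝ) 1) :
    Continuous fun q => greenDeriv q t :=
  LipschitzWith.continuous (K := 2) <| LipschitzWith.of_dist_le_mul fun p q => by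
    rw [Real.dist_eq, ← greenDeriv_sub, dist_eq_norm]
    exact abs_greenDeriv_le _ ht

open Filter Topology in
theorem OneSided.exists_bvpResidual_eq_zero (hf : OneSided L₁ L₂ K k) (hK : 0 ≤ K)
    (hφ : IsBarrier L₁ L₂ K φ)
    (hB : ∀ t ∈ Set.Icc (0 : ℝ) 1, ∀ x x' y, |k t x y - k t x' y| ≤ B)
    (huc : ∀ ε > 0, ∃ δ > 0, ∀ t ∈ Set.Icc (0 : ℝ) 1, ∀ x x' y y', |x - x'| ≤ δ → |y - y'| ≤ δ →
      |k t x y - k t x' y'| ≤ ε) :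
    ∃ q, bvpResidual k hk q = 0 := by
  obtain ⟨Φ, hΦ⟩ := (isCompact_Icc.bddAbove_image hφ.continuousOn)
  replace hΦ : ∀ t ∈ Set.Icc (0 : ℝ) 1, φ t ≤ Φ := fun t ht => hΦ ⟨t, ht, rfl⟩
  choose q hq using fun n : ℕ => hf.exists_norm_bvpResidual_le (hk := hk) hK hφ hB huc
    (Nat.one_div_pos_of_nat (α := ℝ) (n := n))
  have hlim : Tendsto (fun n => ‖bvpResidual k hk (q n)‖) atTop (𝓝 0) :=
    squeeze_zero (fun _ => norm_nonneg _) hq tendsto_one_div_add_atTop_nhds_zero_nat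
  have hcau : CauchySeq q := by
    refine Metric.cauchySeq_iff'.2 fun ε hε => ?_
    obtain ⟨δ, hδ, hmod⟩ := hf.norm_sub_le_of_norm_bvpResidual_le (hk := hk) hφ hΦ hB huc
      (half_pos hε)
    obtain ⟨N, hN⟩ := eventually_atTop.1 (hlim.eventually_le_const hδ)
    refine ⟨N, fun n hn => ?_⟩
    rw [dist_eq_norm]
    exact (hmod _ _ (hN n hn) (hN N le_rfl)).trans_lt (half_lt_self hε)
  obtain ⟨p, hp⟩ := cauchySeq_tendsto_of_complete hcau
  refine ⟨p, ?_⟩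
  ext ⟨t, ht⟩
  have hcont : Continuous fun q => bvpResidual k hk q ⟨t, ht⟩ :=
    (continuous_eval_const (⟨t, ht⟩ : Set.Icc (0 : ℝ) 1)).add (hk.comp (continuous_const.prodMk
      ((continuous_green_apply ht).prodMk (continuous_greenDeriv_apply ht))))
  refine tendsto_nhds_unique ((hcont.tendsto p).comp hp) ?_
  exact squeeze_zero_norm (fun n => (bvpResidual k hk (q n)).norm_coe_le_norm ⟨t, ht⟩) hlim

end Existence

section Truncation

/-- The truncation of `x` to `[-R, R]`. -/
def clamp (R x : ℝ) : ℝ := max (-R) (min R x)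

variable {R x y : ℝ}

theorem continuous_clamp (R : ℝ) : Continuous (clamp R) := by unfold clamp; fun_prop

theorem abs_clamp_le (hR : 0 ≤ R) (x : ℝ) : |clamp R x| ≤ R :=
  abs_le.2 ⟨le_max_left _ _, max_le (by linarith) (min_le_left _ _)⟩

theorem clamp_of_abs_le (hx : |x| ≤ R) : clamp R x = x := by
  rw [abs_le] at hx
  rw [clamp, min_eq_right hx.2, max_eq_right hx.1]

theorem clamp_mono (h : y ≤ x) : clamp R y ≤ clamp R x :=
  max_le_max le_rfl (min_le_min le_rfl h)

theorem clamp_sub_le (h : y ≤ x) : clamp R x - clamp R y ≤ x - y := by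
  unfold clamp
  grind

theorem abs_clamp_sub_le (x y : ℝ) : |clamp R x - clamp R y| ≤ |x - y| := by
  wlog h : y ≤ x generalizing x y
  · rw [abs_sub_comm, abs_sub_comm x]
    exact this y x (le_of_not_ge h)
  rw [abs_of_nonneg (sub_nonneg.2 (clamp_mono h)), abs_of_nonneg (sub_nonneg.2 h)]
  exact clamp_sub_le h

/-- `g` truncated to `|x| ≤ R`, `|y| ≤ S`, extended linearly in `y` with slope `L`. -/
def truncation (R S L : ℝ) (g : ℝ → ℝ → ℝ → ℝ) (t x y : ℝ) : ℝ :=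
  g t (clamp R x) (clamp S y) + L * (y - clamp S y)

variable {L₁ L₂ K S G : ℝ} {g : ℝ → ℝ → ℝ → ℝ}

theorem truncation_eq (t : ℝ) (hx : |x| ≤ R) (hy : |y| ≤ S) :
    truncation R S L₁ g t x y = g t x y := by
  rw [truncation, clamp_of_abs_le hx, clamp_of_abs_le hy, sub_self, mul_zero, add_zero]

theorem continuous_truncation (hg : Continuous fun p : ℝ × ℝ × ℝ => g p.1 p.2.1 p.2.2) :
    Continuous fun p : ℝ × ℝ × ℝ => truncation R S L₁ g p.1 p.2.1 p.2.2 := by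
  have hR := continuous_clamp R
  have hS := continuous_clamp S
  exact (hg.comp (by fun_prop : Continuous fun p : ℝ × ℝ × ℝ =>
    (p.1, clamp R p.2.1, clamp S p.2.2))).add (by fun_prop)

theorem OneSided.truncation_of_nonneg (hf : OneSided L₁ L₂ K g) (hK : 0 ≤ K) :
    OneSided L₁ L₂ K (truncation R S L₁ g) := by
  refine ⟨fun t ht y x x' hx => ?_, fun t ht x y y' hy => ?_⟩
  · have h1 := hf.le_fst t ht (clamp S y) _ _ (clamp_mono (R := R) hx)
    have h2 := mul_le_mul_of_nonneg_left (clamp_sub_le (R := R) hx) hK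
    unfold truncation
    linarith
  · obtain ⟨h1, h2⟩ := hf.snd t ht (clamp R x) _ _ (clamp_mono (R := S) hy)
    have h3 := mul_le_mul_of_nonneg_right hf.le_slopes
      (sub_nonneg.2 (clamp_sub_le (R := S) hy))
    unfold truncation
    constructor <;> linarith

theorem abs_truncation_sub_le_fst (hR : 0 ≤ R) (hS : 0 ≤ S) {t : ℝ}
    (hG : ∀ x y, |x| ≤ R → |y| ≤ S → |g t x y| ≤ G) (x x' y : ℝ) :
    |truncation R S L₁ g t x y - truncation R S L₁ g t x' y| ≤ 2 * G := by
  have h1 := hG _ _ (abs_clamp_le hR x) (abs_clamp_le hS y)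
  have h2 := hG _ _ (abs_clamp_le hR x') (abs_clamp_le hS y)
  rw [truncation, truncation, add_sub_add_right_eq_sub]
  exact (abs_sub _ _).trans (by linarith)

theorem truncation_uniform_continuity (hg : Continuous fun p : ℝ × ℝ × ℝ => g p.1 p.2.1 p.2.2)
    (hR : 0 ≤ R) (hS : 0 ≤ S) {ε : ℝ} (hε : 0 < ε) :
    ∃ δ > 0, ∀ t ∈ Set.Icc (0 : ℝ) 1, ∀ x x' y y', |x - x'| ≤ δ → |y - y'| ≤ δ →
      |truncation R S L₁ g t x y - truncation R S L₁ g t x' y'| ≤ ε := by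
  have hcpt : IsCompact (Set.Icc (0 : ℝ) 1 ×ˢ Set.Icc (-R) R ×ˢ Set.Icc (-S) S) :=
    isCompact_Icc.prod (isCompact_Icc.prod isCompact_Icc)
  obtain ⟨η, hη, h⟩ := Metric.uniformContinuousOn_iff.1
    (hcpt.uniformContinuousOn_of_continuous hg.continuousOn) (ε / 2) (half_pos hε)
  have hmem : ∀ t ∈ Set.Icc (0 : ℝ) 1, ∀ x y, (t, clamp R x, clamp S y) ∈
      Set.Icc (0 : ℝ) 1 ×ˢ Set.Icc (-R) R ×ˢ Set.Icc (-S) S := fun t ht x y =>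
    ⟨ht, abs_le.1 (abs_clamp_le hR x), abs_le.1 (abs_clamp_le hS y)⟩
  refine ⟨min (η / 2) (ε / (4 * (|L₁| + 1))), by positivity, fun t ht x x' y y' hx hy => ?_⟩
  have hx' := (abs_clamp_sub_le (R := R) x x').trans (hx.trans (min_le_left _ _))
  have hy' := (abs_clamp_sub_le (R := S) y y').trans (hy.trans (min_le_left _ _))
  have h1 := h _ (hmem t ht x y) _ (hmem t ht x' y') (by
    rw [Prod.dist_eq, Prod.dist_eq, dist_self, Real.dist_eq, Real.dist_eq]
    exact max_lt hη (max_lt (by linarith) (by linarith)))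
  rw [Real.dist_eq] at h1
  have h2 := hy.trans (min_le_right _ _)
  rw [le_div_iff₀ (by positivity)] at h2
  have h3 : |L₁ * (y - clamp S y) - L₁ * (y' - clamp S y')| ≤ ε / 2 := by
    have h4 : |(y - clamp S y) - (y' - clamp S y')| ≤ 2 * |y - y'| := by
      have := abs_sub (y - y') (clamp S y - clamp S y')
      have := abs_clamp_sub_le (R := S) y y'
      rw [sub_sub_sub_comm]
      linarith
    rw [← mul_sub, abs_mul]
    have := mul_le_mul_of_nonneg_left h4 (abs_nonneg L₁)
    have := abs_nonneg (y - y')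
    linarith
  rw [truncation, truncation, add_sub_add_comm]
  exact (abs_add_le _ _).trans (by linarith)

theorem OneSided.exists_lineExtend_add_eq_zero (hf : OneSided L₁ L₂ K g) (hK : 0 ≤ K)
    {φ : ℝ → ℝ} (hφ : IsBarrier L₁ L₂ K φ)
    (hg : Continuous fun p : ℝ × ℝ × ℝ => g p.1 p.2.1 p.2.2) :
    ∃ q, ∀ t ∈ Set.Icc (0 : ℝ) 1, lineExtend q t + g t (green q t) (greenDeriv q t) = 0 := by
  have hbound : ∀ R S, ∃ G, ∀ t ∈ Set.Icc (0 : ℝ) 1, ∀ x y, |x| ≤ R → |y| ≤ S →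
      |g t x y| ≤ G := fun R S => by
    obtain ⟨G, hG⟩ := (isCompact_Icc.prod (isCompact_Icc.prod isCompact_Icc) :
      IsCompact (Set.Icc (0 : ℝ) 1 ×ˢ Set.Icc (-R) R ×ˢ Set.Icc (-S) S)).exists_bound_of_continuousOn
        hg.continuousOn
    exact ⟨G, fun t ht x y hx hy => hG (t, x, y) ⟨ht, abs_le.1 hx, abs_le.1 hy⟩⟩
  obtain ⟨Φ, hΦ⟩ := isCompact_Icc.bddAbove_image hφ.continuousOn
  replace hΦ : ∀ t ∈ Set.Icc (0 : ℝ) 1, φ t ≤ Φ := fun t ht => hΦ ⟨t, ht, rfl⟩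
  have hΦ0 : 0 ≤ Φ := (hφ.pos 0 (by simp)).le.trans (hΦ 0 (by simp))
  obtain ⟨M, hM⟩ := hbound 0 0
  have hM0 : 0 ≤ M := (abs_nonneg _).trans (hM 0 (by simp) 0 0 (by simp) (by simp))
  obtain ⟨R, hR⟩ : ∃ R, R = M * Φ := ⟨_, rfl⟩
  have hR0 : 0 ≤ R := hR ▸ mul_nonneg hM0 hΦ0
  obtain ⟨b, hb⟩ := hbound R 0
  have hb0 : 0 ≤ b := (abs_nonneg _).trans (hb 0 (by simp) 0 0 (by simpa using hR0) (by simp))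
  obtain ⟨Λ, hΛ⟩ : ∃ Λ, Λ = |L₁| + |L₂| := ⟨_, rfl⟩
  have hΛ0 : 0 ≤ Λ := by rw [hΛ]; positivity
  obtain ⟨S, hS⟩ : ∃ S, S = 2 * (4 * (Λ + 1) * R + b) := ⟨_, rfl⟩
  have hS0 : 0 ≤ S := by rw [hS]; positivity
  obtain ⟨G, hG⟩ := hbound R S
  have hk := continuous_truncation (R := R) (S := S) (L₁ := L₁) hg
  have hf' : OneSided L₁ L₂ K (truncation R S L₁ g) := hf.truncation_of_nonneg hK
  obtain ⟨q, hq⟩ := hf'.exists_bvpResidual_eq_zero (hk := hk) hK hφ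
    (fun t ht => abs_truncation_sub_le_fst hR0 hS0 (hG t ht))
    (fun ε hε => truncation_uniform_continuity hg hR0 hS0 hε)
  have hq' : ∀ t ∈ Set.Icc (0 : ℝ) 1,
      lineExtend q t + truncation R S L₁ g t (green q t) (greenDeriv q t) = 0 := fun t ht => by
    rw [← bvpResidual_apply (hk := hk) q ht, hq]; rfl
  have g0 : ∀ t, green 0 t = 0 := fun t => by simpa using green_sub 0 0 t
  have g1 : ∀ t, greenDeriv 0 t = 0 := fun t => by simpa using greenDeriv_sub 0 0 t
  have e0 : ∀ t, lineExtend 0 t = 0 := fun t => by simpa using lineExtend_sub 0 0 t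
  have hres : ‖bvpResidual _ hk 0‖ ≤ M := by
    rw [ContinuousMap.norm_le _ hM0]
    rintro ⟨t, ht⟩
    rw [bvpResidual_apply, g0, g1, e0, zero_add, truncation_eq t (by simpa) (by simpa)]
    exact hM t ht 0 0 (by simp) (by simp)
  have hw : ∀ t ∈ Set.Icc (0 : ℝ) 1, |green q t| ≤ R := fun t ht => by
    have := hf'.abs_green_sub_le (hk := hk) hφ hΦ q 0 ht
    rw [hq, zero_sub, norm_neg, g0, sub_zero] at this
    exact (this.trans (mul_le_mul_of_nonneg_right hres hΦ0)).trans_eq hR.symm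
  have hh : 1 / (2 * (Λ + 1)) ≤ 1 / 2 := by
    apply one_div_le_one_div_of_le two_pos; linarith
  have hw₁ : ∀ t ∈ Set.Icc (0 : ℝ) 1,
      |greenDeriv q t| ≤ 4 * (Λ + 1) * R + ‖q‖ / (2 * (Λ + 1)) := fun t ht => by
    have := abs_greenDeriv_sub_le (p := q) (q := 0) (a := R)
      (fun s hs => by rw [g0, sub_zero]; exact hw s hs) (by positivity) hh ht
    rw [g1, sub_zero, sub_zero] at this
    refine this.trans_eq ?_
    field_simp
    ring
  have hnorm : ‖q‖ ≤ b + Λ * (4 * (Λ + 1) * R + ‖q‖ / (2 * (Λ + 1))) := by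
    rw [ContinuousMap.norm_le _ (by positivity)]
    rintro ⟨t, ht⟩
    have h1 := hf'.abs_sub_snd_le ht (green q t) (greenDeriv q t) 0
    have h2 := hb t ht _ 0 (hw t ht) (by simp)
    have h3 := mul_le_mul_of_nonneg_left (hw₁ t ht) hΛ0
    rw [truncation_eq (y := 0) t (hw t ht) (by simpa), sub_zero, ← hΛ] at h1
    rw [← lineExtend_apply q ht, eq_neg_of_add_eq_zero_left (hq' t ht), norm_neg, Real.norm_eq_abs]
    rw [abs_le] at h1 h2 ⊢
    constructor <;> linarith [h1.1, h1.2, h2.1, h2.2]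
  obtain ⟨z, hz⟩ : ∃ z, z = ‖q‖ / (2 * (Λ + 1)) := ⟨_, rfl⟩
  have hqz : ‖q‖ = 2 * (Λ + 1) * z := by rw [hz]; field_simp
  have hz0 : 0 ≤ z := by rw [hz]; positivity
  have hw₁S : ∀ t ∈ Set.Icc (0 : ℝ) 1, |greenDeriv q t| ≤ S := fun t ht => by
    refine (hw₁ t ht).trans ?_
    rw [← hz] at hnorm ⊢
    rw [hqz] at hnorm
    have h1 : 0 ≤ (Λ + 1) * R := by positivity
    have h2 : (Λ + 2) * z ≤ (Λ + 2) * (4 * (Λ + 1) * R + b) := by nlinarith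
    have h3 := le_of_mul_le_mul_left h2 (by linarith)
    linarith
  refine ⟨q, fun t ht => ?_⟩
  rw [← truncation_eq (R := R) (S := S) (L₁ := L₁) (g := g) t (hw t ht) (hw₁S t ht)]
  exact hq' t ht

end Truncation

section BoundaryValueProblem

variable {L₁ L₂ K : ℝ} {f : ℝ → ℝ → ℝ → ℝ} {ω φ u u' v v' : ℝ → ℝ}

theorem SolBVP.continuousOn_rhs (hu : SolBVP f ω u u')
    (hf : ContinuousOn (fun p : ℝ × ℝ × ℝ => f p.1 p.2.1 p.2.2)
      (Set.Icc 0 1 ×ˢ (Set.univ : Set (ℝ × ℝ)))) :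
    ContinuousOn (fun s => f s (u s) (u' s)) (Set.Icc 0 1) :=
  hf.comp (f := fun s => (s, u s, u' s)) (continuousOn_id.prodMk
    ((HasDerivWithinAt.continuousOn hu.1).prodMk hu.2.1)) fun _ hs => ⟨hs, trivial⟩

theorem SolBVP.le (hu : SolBVP f ω u u') (hv : SolBVP f ω v v')
    (hf : ContinuousOn (fun p : ℝ × ℝ × ℝ => f p.1 p.2.1 p.2.2)
      (Set.Icc 0 1 ×ˢ (Set.univ : Set (ℝ × ℝ))))
    (hos : OneSided L₁ L₂ K f) (hφ : IsBarrier L₁ L₂ K φ) {t : ℝ} (ht : t ∈ Set.Icc (0 : ℝ) 1) :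
    u t ≤ v t := by
  have hcu := hu.continuousOn_rhs hf
  have hcv := hv.continuousOn_rhs hf
  obtain ⟨hdu, -, hu0, hu1, heu⟩ := hu
  obtain ⟨hdv, -, hv0, hv1, hev⟩ := hv
  have hint : ∀ {F : ℝ → ℝ}, ContinuousOn F (Set.Icc 0 1) → ∀ s ∈ Set.Icc (0 : ℝ) 1,
      IntervalIntegrable F volume 0 s := fun hF s hs =>
    (hF.mono (by rw [Set.uIcc_of_le hs.1]; exact Set.Icc_subset_Icc_right hs.2)).intervalIntegrable
  have hFTC : ∀ {F : ℝ → ℝ}, ContinuousOn F (Set.Icc 0 1) → ∀ s ∈ Set.Ioo (0 : ℝ) 1,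
      HasDerivAt (fun r => ∫ x in (0 : ℝ)..r, F x) (F s) s := fun hF s hs => by
    have hnhds := Icc_mem_nhds hs.1 hs.2
    exact intervalIntegral.integral_hasDerivAt_right (hint hF s (Set.Ioo_subset_Icc_self hs))
      (hF.stronglyMeasurableAtFilter_nhdsWithin measurableSet_Icc s |>.filter_mono (by
        rw [nhdsWithin_eq_nhds.2 hnhds])) (hF.continuousAt hnhds)
  have := hos.sub_le_mul (M := 0) (u := u) (v := v) (u₁ := u') (v₁ := v')
    (d := fun s => -(f s (u s) (u' s) - f s (v s) (v' s))) hφ le_rfl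
    ((HasDerivWithinAt.continuousOn hdu).sub (HasDerivWithinAt.continuousOn hdv))
    (fun s hs => ((hdu s (Set.Ioo_subset_Icc_self hs)).sub
      (hdv s (Set.Ioo_subset_Icc_self hs))).hasDerivAt (Icc_mem_nhds hs.1 hs.2))
    (fun s hs => by
      refine (((hFTC hcu s hs).sub (hFTC hcv s hs)).neg.const_add (u' 0 - v' 0)
        ).congr_of_eventuallyEq ?_
      filter_upwards [Icc_mem_nhds hs.1 hs.2] with r hr
      have h1 := heu r hr
      have h2 := hev r hr
      simp only [Pi.neg_apply, Pi.sub_apply]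
      linarith)
    (hu0.trans hv0.symm) (hu1.trans hv1.symm) (fun s _ => by simp) t ht
  linarith

theorem exists_solBVP (hf : ContinuousOn (fun p : ℝ × ℝ × ℝ => f p.1 p.2.1 p.2.2)
      (Set.Icc 0 1 ×ˢ (Set.univ : Set (ℝ × ℝ))))
    (hos : OneSided L₁ L₂ K f) (hK : 0 ≤ K) (hφ : IsBarrier L₁ L₂ K φ)
    (hω : ContinuousOn ω (Set.Icc 0 1)) (hω0 : ω 0 = 0) : ∃ u u', SolBVP f ω u u' := by
  obtain ⟨π, hπ⟩ : ∃ π : ℝ → ℝ, π = fun t => (Set.projIcc 0 1 zero_le_one t : ℝ) := ⟨_, rfl⟩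
  have hπc : Continuous π := by
    rw [hπ]; exact continuous_subtype_val.comp continuous_projIcc
  have hπm : ∀ t, π t ∈ Set.Icc (0 : ℝ) 1 := fun t => by rw [hπ]; exact Subtype.coe_prop _
  have hπi : ∀ t ∈ Set.Icc (0 : ℝ) 1, π t = t := fun t ht => by
    rw [hπ]; simp only [Set.projIcc_of_mem zero_le_one ht]
  have hΩ : Continuous fun t => ω (π t) := hω.comp_continuous hπc hπm
  obtain ⟨c, hc⟩ : ∃ c, c = ∫ s in (0 : ℝ)..1, ω (π s) := ⟨_, rfl⟩
  obtain ⟨V', hV'⟩ : ∃ V' : ℝ → ℝ, V' = fun t => ω (π t) - c := ⟨_, rfl⟩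
  obtain ⟨V, hV⟩ : ∃ V : ℝ → ℝ, V = fun t => ∫ s in (0 : ℝ)..t, V' s := ⟨_, rfl⟩
  have hV'c : Continuous V' := by rw [hV']; exact hΩ.sub continuous_const
  have hVd : ∀ t, HasDerivAt V (V' t) t := fun t => by
    rw [hV]; exact (hV'c.integral_hasStrictDerivAt 0 t).hasDerivAt
  have hVc : Continuous V := continuous_iff_continuousAt.2 fun t => (hVd t).continuousAt
  have hV0 : V 0 = 0 := by rw [hV]; exact intervalIntegral.integral_same
  have hV1 : V 1 = 0 := by
    rw [hV, hV']
    simp only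
    rw [intervalIntegral.integral_sub (hΩ.intervalIntegrable _ _) (by simp), ← hc]
    simp
  have hg : Continuous fun p : ℝ × ℝ × ℝ => f (π p.1) (p.2.1 + V (π p.1)) (p.2.2 + V' (π p.1)) :=
    hf.comp_continuous (f := fun p : ℝ × ℝ × ℝ => (π p.1, p.2.1 + V (π p.1), p.2.2 + V' (π p.1)))
      (by fun_prop) fun p => ⟨hπm _, trivial⟩
  have hosg : OneSided L₁ L₂ K fun t x y => f (π t) (x + V (π t)) (y + V' (π t)) := by
    refine ⟨fun t _ y x x' hx => ?_, fun t _ x y y' hy => ?_⟩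
    · simpa using hos.le_fst _ (hπm t) (y + V' (π t)) (x + V (π t)) (x' + V (π t)) (by linarith)
    · simpa using hos.snd _ (hπm t) (x + V (π t)) (y + V' (π t)) (y' + V' (π t)) (by linarith)
  obtain ⟨q, hq⟩ := hosg.exists_lineExtend_add_eq_zero hK hφ hg
  refine ⟨fun t => green q t + V t, fun t => greenDeriv q t + V' t,
    fun t _ => ((hasDerivAt_green q t).add (hVd t)).hasDerivWithinAt,
    ((continuous_greenDeriv q).add hV'c).continuousOn, by simp [hV0], by simp [hV1],
    fun t ht => ?_⟩
  have hint : ∫ s in (0 : ℝ)..t, f s (green q s + V s) (greenDeriv q s + V' s) =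
      ∫ s in (0 : ℝ)..t, -lineExtend q s := by
    refine intervalIntegral.integral_congr fun s hs => ?_
    rw [Set.uIcc_of_le ht.1] at hs
    have hs' : s ∈ Set.Icc (0 : ℝ) 1 := ⟨hs.1, hs.2.trans ht.2⟩
    have := hq s hs'
    rw [hπi s hs'] at this
    linarith
  have hftc := intervalIntegral.integral_eq_sub_of_hasDerivAt
    (fun s (_ : s ∈ Set.uIcc 0 t) => hasDerivAt_greenDeriv q s)
    ((continuous_lineExtend q).intervalIntegrable _ _)
  simp only [hint, intervalIntegral.integral_neg, hftc]
  simp only [hV', hπi t ht, hπi 0 (by simp), hω0]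
  ring

end BoundaryValueProblem

/-- existence and uniqueness under generalized (one-sided) Lipschitz
conditions with `1 < α(L₂,K) + β(L₁,K)`. -/
theorem stmt9 (f : ℝ → ℝ → ℝ → ℝ)
    (hf : ContinuousOn (fun p : ℝ × ℝ × ℝ => f p.1 p.2.1 p.2.2)
      (Set.Icc 0 1 ×ˢ (Set.univ : Set (ℝ × ℝ))))
    (hLL : ∀ t ∈ Set.Icc (0:ℝ) 1, LocallyLipschitz (fun p : ℝ × ℝ => f t p.1 p.2))
    (K L1 L2 : ℝ)
    (hK : ∀ t ∈ Set.Icc (0:ℝ) 1, ∀ y x x' : ℝ, x' ≤ x →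
      f t x y - f t x' y ≤ K * (x - x'))
    (hL : ∀ t ∈ Set.Icc (0:ℝ) 1, ∀ x y y' : ℝ, y' ≤ y →
      L1 * (y - y') ≤ f t x y - f t x y' ∧ f t x y - f t x y' ≤ L2 * (y - y'))
    (hαβ : (1 : EReal) < alphaBSW L2 K + betaBSW L1 K)
    (ω : ℝ → ℝ) (hω : ContinuousOn ω (Set.Icc 0 1)) (hω0 : ω 0 = 0) :
    (∃ u u' : ℝ → ℝ, SolBVP f ω u u') ∧
    (∀ u u' v v' : ℝ → ℝ, SolBVP f ω u u' → SolBVP f ω v v' →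
      Set.EqOn u v (Set.Icc 0 1)) := by
  obtain ⟨K', hK', hos, φ, hφ⟩ : ∃ K', 0 ≤ K' ∧ OneSided L1 L2 K' f ∧ ∃ φ, IsBarrier L1 L2 K' φ := by
    rcases le_total 0 K with h | h
    · exact ⟨K, h, ⟨hK, hL⟩, exists_barrier h hαβ⟩
    · refine ⟨0, le_rfl, ⟨fun t ht y x x' hx => (hK t ht y x x' hx).trans ?_, hL⟩,
        exists_barrier le_rfl ?_⟩
      · exact mul_le_mul_of_nonneg_right h (sub_nonneg.2 hx)
      · rw [betaBSW, alphaBSW_of_nonpos _ le_rfl, alphaBSW_of_nonpos _ le_rfl]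
        simpa using EReal.coe_lt_top 1
  exact ⟨exists_solBVP hf hos hK' hφ hω hω0, fun u u' v v' hu hv t ht =>
    le_antisymm (hu.le hv hf hos hφ ht) (hv.le hu hf hos hφ ht)⟩
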